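/- Let n be a positive even integer and λ, ν ∈ ℂ. Then dim V^{+1}(λ,ν) + dim V^{−1}(λ,ν) = 3 if (λ,ν) ∈ L̂, and dim V^{+1}(λ,ν) + dim V^{−1}(λ,ν) = 2 otherwise. -/

import Mathlib

/-- Extension of `s : ℕ×ℕ → ℂ` to integer indices, with the convention that `s(i,j) = 0`
whenever `i < 0`, `j < 0` or `j > i`. -/
noncomputable def extS (s : ℕ × ℕ → ℂ) : ℤ → ℤ → ℂ :=
  fun i j => if 0 ≤ i ∧ 0 ≤ j ∧ j ≤ i then s (i.toNat, j.toNat) else 0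

lemma extS_add (a b : ℕ × ℕ → ℂ) (i j : ℤ) :
    extS (a + b) i j = extS a i j + extS b i j := by
  unfold extS; split <;> simp

lemma extS_smul (r : ℂ) (a : ℕ × ℕ → ℂ) (i j : ℤ) :
    extS (r • a) i j = r * extS a i j := by
  unfold extS; split <;> simp

/-- The space `V^ε(λ,ν)` of functions `s : ℕ×ℕ → ℂ`, vanishing for `j > i`, satisfying the
three relations (R1), (R2), (R3) for all integers `i ≥ j ≥ 0` (with the convention that
`s(i,j) = 0` whenever `i < 0`, `j < 0` or `j > i`).  Here `ρ = n/2` and `ρ_H = (n−1)/2`. -/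
noncomputable def Vsp (n : ℕ) (eps lam nu : ℂ) : Submodule ℂ (ℕ × ℕ → ℂ) where
  carrier := {s | (∀ p : ℕ × ℕ, p.1 < p.2 → s p = 0)
    ∧ (∀ i j : ℕ, j ≤ i →
        ((n : ℂ) + 2 * i - 1) * ((n : ℂ) + 2 * i + 1)
            * (nu + ((n : ℂ) - 1) / 2 + 1 / 2 + j) * s (i, j)
          = ((n : ℂ) + 2 * i - 1) * ((n : ℂ) + 2 * j - 1)
              * (lam + (n : ℂ) / 2 + 1 / 2 + i) * extS s ((i : ℤ) + 1) ((j : ℤ) + 1)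
            + eps * (-1 : ℂ) ^ (i - j + 1) * 2 * ((n : ℂ) + 2 * j - 1)
              * Complex.I * lam * extS s (i : ℤ) ((j : ℤ) + 1)
            - ((n : ℂ) + 2 * i + 1) * ((n : ℂ) + 2 * j - 1)
              * (lam - (n : ℂ) / 2 + 1 / 2 - i) * extS s ((i : ℤ) - 1) ((j : ℤ) + 1))
    ∧ (∀ i j : ℕ, j ≤ i →
        (((n : ℂ) + 2 * i - 1) * ((n : ℂ) + 2 * i + 1) * nu
            - eps * (-1 : ℂ) ^ (i - j) * ((n : ℂ) + 2 * i) * ((n : ℂ) + 2 * j - 1) * lam)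
            * s (i, j)
          = -(((i : ℂ) - j + 1)) * ((n : ℂ) + 2 * i - 1) * Complex.I
              * (lam + (n : ℂ) / 2 + 1 / 2 + i) * extS s ((i : ℤ) + 1) (j : ℤ)
            + ((n : ℂ) + 2 * i + 1) * ((n : ℂ) + i + j - 1) * Complex.I
              * (lam - (n : ℂ) / 2 + 1 / 2 - i) * extS s ((i : ℤ) - 1) (j : ℤ))
    ∧ (∀ i j : ℕ, 1 ≤ j → j ≤ i →
        ((n : ℂ) + 2 * i - 1) * ((n : ℂ) + 2 * i + 1) * ((n : ℂ) + 2 * j - 3)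
            * (nu - ((n : ℂ) - 1) / 2 + 1 / 2 - j) * s (i, j)
          = -(((i : ℂ) - j + 1)) * (((i : ℂ) - j + 2)) * ((n : ℂ) + 2 * i - 1)
              * (lam + (n : ℂ) / 2 + 1 / 2 + i) * extS s ((i : ℤ) + 1) ((j : ℤ) - 1)
            + eps * (-1 : ℂ) ^ (i - j + 1) * 2 * (((i : ℂ) - j + 1)) * ((n : ℂ) + i + j - 1)
              * Complex.I * lam * extS s (i : ℤ) ((j : ℤ) - 1)
            + ((n : ℂ) + 2 * i + 1) * ((n : ℂ) + i + j - 2) * ((n : ℂ) + i + j - 1)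
              * (lam - (n : ℂ) / 2 + 1 / 2 - i) * extS s ((i : ℤ) - 1) ((j : ℤ) - 1))}
  add_mem' := by
    rintro a b ⟨ha0, ha1, ha2, ha3⟩ ⟨hb0, hb1, hb2, hb3⟩
    refine ⟨fun p hp => by simp [Pi.add_apply, ha0 p hp, hb0 p hp], ?_, ?_, ?_⟩
    · intro i j hij
      simp only [Pi.add_apply, extS_add]
      linear_combination ha1 i j hij + hb1 i j hij
    · intro i j hij
      simp only [Pi.add_apply, extS_add]
      linear_combination ha2 i j hij + hb2 i j hij
    · intro i j h1 hij
      simp only [Pi.add_apply, extS_add]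
      linear_combination ha3 i j h1 hij + hb3 i j h1 hij
  zero_mem' := by
    refine ⟨fun p _ => rfl, ?_, ?_, ?_⟩ <;>
      · intro i j
        intros
        simp [extS]
  smul_mem' := by
    rintro r a ⟨ha0, ha1, ha2, ha3⟩
    refine ⟨fun p hp => by simp [Pi.smul_apply, ha0 p hp], ?_, ?_, ?_⟩
    · intro i j hij
      simp only [Pi.smul_apply, smul_eq_mul, extS_smul]
      linear_combination r * ha1 i j hij
    · intro i j hij
      simp only [Pi.smul_apply, smul_eq_mul, extS_smul]
      linear_combination r * ha2 i j hij
    · intro i j h1 hij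
      simp only [Pi.smul_apply, smul_eq_mul, extS_smul]
      linear_combination r * ha3 i j h1 hij

/-- The set `L̂ = {(λ,ν) : λ = -ρ-1/2-k, ν = -ρ_H-1/2-ℓ, k ≥ ℓ ≥ 0}`, where `ρ = n/2` and
`ρ_H = (n-1)/2`. -/
def Lhat (n : ℕ) : Set (ℂ × ℂ) :=
  {p | ∃ k l : ℕ, l ≤ k ∧ p.1 = -((n : ℂ) / 2) - 1 / 2 - k ∧
    p.2 = -(((n : ℂ) - 1) / 2) - 1 / 2 - l}

set_option linter.unusedSimpArgs false


/-! ### The normalised system -/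

noncomputable def qd (n : ℕ) (lam : ℂ) (i : ℕ) : ℂ := lam / ((n : ℂ) + 2 * i - 1)

noncomputable def sg (eps : ℂ) (a : ℕ) : ℂ := eps * (-1 : ℂ) ^ a

noncomputable def mj (n j : ℕ) : ℂ := (n : ℂ) / 2 + j

noncomputable def opT (n : ℕ) (eps lam : ℂ) (j : ℕ) (x : ℕ → ℂ) (a : ℕ) : ℂ :=
  sg eps a * ((n : ℂ) + 2 * j - 1) * (qd n lam (a + j + 1) + qd n lam (a + j)) / 2 * x a
    + (qd n lam (a + j + 1) + 1 / 2) * x (a + 1)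
    + (a : ℂ) * ((n : ℂ) + a + 2 * j - 1) * (qd n lam (a + j) - 1 / 2) * x (a - 1)

noncomputable def opA (n : ℕ) (eps lam : ℂ) (j : ℕ) (x : ℕ → ℂ) (a : ℕ) : ℂ :=
  (qd n lam (a + j + 1) + 1 / 2) * x a
    - sg eps a * a * (qd n lam (a + j) - qd n lam (a + j + 1)) * x (a - 1)
    + (a : ℂ) * ((a : ℂ) - 1) * (qd n lam (a + j) - 1 / 2) * x (a - 2)

noncomputable def opB (n : ℕ) (eps lam : ℂ) (j : ℕ) (x : ℕ → ℂ) (a : ℕ) : ℂ :=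
  (qd n lam (a + j + 2) + 1 / 2) * x (a + 2)
    + sg eps a * ((n : ℂ) + a + 2 * j + 1) * (qd n lam (a + j + 1) - qd n lam (a + j + 2))
      * x (a + 1)
    + ((n : ℂ) + a + 2 * j) * ((n : ℂ) + a + 2 * j + 1) * (qd n lam (a + j + 1) - 1 / 2) * x a

lemma sg_succ (eps : ℂ) (a : ℕ) : sg eps (a + 1) = - sg eps a := by
  unfold sg; rw [pow_succ]; ring

lemma sg_cases {eps : ℂ} (he : eps = 1 ∨ eps = -1) (a : ℕ) : sg eps a = 1 ∨ sg eps a = -1 := by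
  unfold sg
  rcases he with h | h <;> rcases neg_one_pow_eq_or ℂ a with h' | h' <;> rw [h, h'] <;> simp

lemma odd_ne {n : ℕ} (hne : Even n) (z : ℤ) (hz : Odd z) : (n : ℂ) + z ≠ 0 := by
  intro h
  have h1 : ((n : ℤ) + z) = 0 := by exact_mod_cast h
  obtain ⟨r, hr⟩ := hne
  obtain ⟨t, ht⟩ := hz
  omega

lemma den_ne {n : ℕ} (hne : Even n) (i : ℕ) : (n : ℂ) + 2 * i - 1 ≠ 0 := by
  have := odd_ne hne (2 * (i : ℤ) - 1) ⟨(i : ℤ) - 1, by ring⟩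
  push_cast at this
  intro h; apply this; linear_combination h

lemma qd_succ {n : ℕ} (hne : Even n) (lam : ℂ) (i : ℕ) :
    qd n lam (i + 1) = qd n lam i * ((n : ℂ) + 2 * i - 1) / ((n : ℂ) + 2 * i + 1) := by
  unfold qd
  have h1 := den_ne hne i
  have h2 := den_ne hne (i + 1)
  push_cast at h2 ⊢
  rw [div_mul_cancel₀ _ h1]
  congr 1; ring


lemma nat_sub_two (b : ℕ) : b + 1 + 1 - 2 = b := rfl

lemma qd_mul {n : ℕ} (hne : Even n) (lam : ℂ) (i : ℕ) :
    qd n lam i * ((n : ℂ) + 2 * i - 1) = lam := by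
  unfold qd
  exact div_mul_cancel₀ _ (den_ne hne i)

lemma qd_param {n : ℕ} (hne : Even n) (lam : ℂ) (i : ℕ) : ∃ D0 D1 D2 D3 : ℂ,
    qd n lam i = D0 ∧ qd n lam (i + 1) = D1 ∧ qd n lam (i + 1 + 1) = D2 ∧
    qd n lam (i + 1 + 1 + 1) = D3 ∧ D0 * ((n : ℂ) + 2 * i - 1) = lam ∧
    D1 * ((n : ℂ) + 2 * i + 1) = lam ∧ D2 * ((n : ℂ) + 2 * i + 3) = lam ∧
    D3 * ((n : ℂ) + 2 * i + 5) = lam := by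
  refine ⟨_, _, _, _, rfl, rfl, rfl, rfl, qd_mul hne lam i, ?_, ?_, ?_⟩
  · have := qd_mul hne lam (i + 1)
    push_cast at this
    linear_combination this
  · have := qd_mul hne lam (i + 1 + 1)
    push_cast at this
    linear_combination this
  · have := qd_mul hne lam (i + 1 + 1 + 1)
    push_cast at this
    linear_combination this

theorem opT_opA {n : ℕ} (hne : Even n) {eps : ℂ} (he : eps = 1 ∨ eps = -1) (lam : ℂ) (j : ℕ)
    (x : ℕ → ℂ) (a : ℕ) :
    opT n eps lam j (opA n eps lam j x) a
      = opA n eps lam j (opT n eps lam (j + 1) x) a := by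
  rcases a with _ | _ | _ | a
  all_goals
    simp only [opT, opA, sg_succ, Nat.add_sub_cancel, nat_sub_two, Nat.zero_sub, Nat.zero_add, Nat.sub_self]
  · obtain ⟨D0, D1, D2, D3, e0, e1, e2, e3, r0, r1, r2, r3⟩ := qd_param hne lam (j)
    push_cast at r0 r1 r2 r3
    simp only [Nat.add_assoc, Nat.add_comm, Nat.add_left_comm] at e0 e1 e2 e3 ⊢
    simp only [e0, e1, e2, e3]
    push_cast
    rcases sg_cases he 0 with h | h
    · rw [h]
      linear_combination (1) * (D1 + 1 / 2) / 2 * (x 0) * (r0 - r2)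
    · rw [h]
      linear_combination (-1) * (D1 + 1 / 2) / 2 * (x 0) * (r0 - r2)
  · obtain ⟨D0, D1, D2, D3, e0, e1, e2, e3, r0, r1, r2, r3⟩ := qd_param hne lam (j)
    push_cast at r0 r1 r2 r3
    simp only [Nat.add_assoc, Nat.add_comm, Nat.add_left_comm] at e0 e1 e2 e3 ⊢
    simp only [e0, e1, e2, e3]
    push_cast
    rcases sg_cases he 0 with h | h
    · rw [h]
      linear_combination (-1) * (D2 + 1 / 2) / 2 * (x 1) * (r1 - r3)
    · rw [h]
      linear_combination (1) * (D2 + 1 / 2) / 2 * (x 1) * (r1 - r3)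
  · obtain ⟨D0, D1, D2, D3, e0, e1, e2, e3, r0, r1, r2, r3⟩ := qd_param hne lam (j + 1)
    push_cast at r0 r1 r2 r3
    simp only [Nat.add_assoc, Nat.add_comm, Nat.add_left_comm] at e0 e1 e2 e3 ⊢
    simp only [e0, e1, e2, e3]
    push_cast
    rcases sg_cases he 0 with h | h
    · rw [h]
      linear_combination (1) * (D2 + 1 / 2) / 2 * (x 2) * (r1 - r3) + (1) * (2 : ℂ) * ((2 : ℂ) - 1) * (D1 - 1 / 2) / 2 * (x 0) * (r0 - r2)
    · rw [h]
      linear_combination (-1) * (D2 + 1 / 2) / 2 * (x 2) * (r1 - r3) + (-1) * (2 : ℂ) * ((2 : ℂ) - 1) * (D1 - 1 / 2) / 2 * (x 0) * (r0 - r2)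
  · obtain ⟨D0, D1, D2, D3, e0, e1, e2, e3, r0, r1, r2, r3⟩ := qd_param hne lam (a + j + 1 + 1)
    push_cast at r0 r1 r2 r3
    simp only [Nat.add_assoc, Nat.add_comm, Nat.add_left_comm] at e0 e1 e2 e3 ⊢
    simp only [e0, e1, e2, e3]
    push_cast
    rcases sg_cases he a with h | h
    · rw [h]
      linear_combination (-1) * (D2 + 1 / 2) / 2 * (x (((a + 1) + 1) + 1)) * (r1 - r3) + (-1) * ((a : ℂ) + 3) * (((a : ℂ) + 3) - 1) * (D1 - 1 / 2) / 2 * (x (a + 1)) * (r0 - r2)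
    · rw [h]
      linear_combination (1) * (D2 + 1 / 2) / 2 * (x (((a + 1) + 1) + 1)) * (r1 - r3) + (1) * ((a : ℂ) + 3) * (((a : ℂ) + 3) - 1) * (D1 - 1 / 2) / 2 * (x (a + 1)) * (r0 - r2)

theorem opT_opB {n : ℕ} (hne : Even n) {eps : ℂ} (he : eps = 1 ∨ eps = -1) (lam : ℂ) (j : ℕ)
    (x : ℕ → ℂ) (a : ℕ) :
    opT n eps lam (j + 1) (opB n eps lam j x) a
      = opB n eps lam j (opT n eps lam j x) a := by
  rcases a with _ | a
  all_goals
    simp only [opT, opB, sg_succ, Nat.add_sub_cancel, nat_sub_two, Nat.zero_sub, Nat.zero_add, Nat.sub_self]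
  · obtain ⟨D0, D1, D2, D3, e0, e1, e2, e3, r0, r1, r2, r3⟩ := qd_param hne lam (j)
    push_cast at r0 r1 r2 r3
    simp only [Nat.add_assoc, Nat.add_comm, Nat.add_left_comm] at e0 e1 e2 e3 ⊢
    simp only [e0, e1, e2, e3]
    push_cast
    rcases sg_cases he 0 with h | h
    · rw [h]
      linear_combination (1) * (D2 + 1 / 2) / 2 * (x 2) * (r3 - r1) + (1) * ((n : ℂ) + (0 : ℂ) + 2 * j) * (((n : ℂ) + (0 : ℂ) + 2 * j) + 1) * (D1 - 1 / 2) / 2 * (x 0) * (r2 - r0)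
    · rw [h]
      linear_combination (-1) * (D2 + 1 / 2) / 2 * (x 2) * (r3 - r1) + (-1) * ((n : ℂ) + (0 : ℂ) + 2 * j) * (((n : ℂ) + (0 : ℂ) + 2 * j) + 1) * (D1 - 1 / 2) / 2 * (x 0) * (r2 - r0)
  · obtain ⟨D0, D1, D2, D3, e0, e1, e2, e3, r0, r1, r2, r3⟩ := qd_param hne lam (a + j + 1)
    push_cast at r0 r1 r2 r3
    simp only [Nat.add_assoc, Nat.add_comm, Nat.add_left_comm] at e0 e1 e2 e3 ⊢
    simp only [e0, e1, e2, e3]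
    push_cast
    rcases sg_cases he a with h | h
    · rw [h]
      linear_combination (-1) * (D2 + 1 / 2) / 2 * (x (((a + 1) + 1) + 1)) * (r3 - r1) + (-1) * ((n : ℂ) + ((a : ℂ) + 1) + 2 * j) * (((n : ℂ) + ((a : ℂ) + 1) + 2 * j) + 1) * (D1 - 1 / 2) / 2 * (x (a + 1)) * (r2 - r0)
    · rw [h]
      linear_combination (1) * (D2 + 1 / 2) / 2 * (x (((a + 1) + 1) + 1)) * (r3 - r1) + (1) * ((n : ℂ) + ((a : ℂ) + 1) + 2 * j) * (((n : ℂ) + ((a : ℂ) + 1) + 2 * j) + 1) * (D1 - 1 / 2) / 2 * (x (a + 1)) * (r2 - r0)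

theorem opB_opA {n : ℕ} (hne : Even n) {eps : ℂ} (he : eps = 1 ∨ eps = -1) (lam : ℂ) (j : ℕ)
    (x : ℕ → ℂ) (a : ℕ) :
    opB n eps lam j (opA n eps lam j x) a
      = opT n eps lam (j + 1) (opT n eps lam (j + 1) x) a - mj n j ^ 2 * x a := by
  rcases a with _ | _ | a
  all_goals
    simp only [opT, opA, opB, mj, sg_succ, Nat.add_sub_cancel, nat_sub_two, Nat.zero_sub, Nat.zero_add, Nat.sub_self]
  · obtain ⟨D0, D1, D2, D3, e0, e1, e2, e3, r0, r1, r2, r3⟩ := qd_param hne lam (j)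
    push_cast at r0 r1 r2 r3
    simp only [Nat.add_assoc, Nat.add_comm, Nat.add_left_comm] at e0 e1 e2 e3 ⊢
    simp only [e0, e1, e2, e3]
    push_cast
    rcases sg_cases he 0 with h | h
    · rw [h]
      linear_combination (1) * (D2 + 1 / 2) / 2 * (x 1) * (r3 + r1 - 2 * r2) + ((2 * (0 : ℂ) + 1 - ((n : ℂ) + 2 * j)) / 4 * D2 - (3 * ((n : ℂ) + 2 * j) + 2 * (0 : ℂ) + 3) / 4 * D1) * (x 0) * (r2 - r1)
    · rw [h]
      linear_combination (-1) * (D2 + 1 / 2) / 2 * (x 1) * (r3 + r1 - 2 * r2) + ((2 * (0 : ℂ) + 1 - ((n : ℂ) + 2 * j)) / 4 * D2 - (3 * ((n : ℂ) + 2 * j) + 2 * (0 : ℂ) + 3) / 4 * D1) * (x 0) * (r2 - r1)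
  · obtain ⟨D0, D1, D2, D3, e0, e1, e2, e3, r0, r1, r2, r3⟩ := qd_param hne lam (j + 1)
    push_cast at r0 r1 r2 r3
    simp only [Nat.add_assoc, Nat.add_comm, Nat.add_left_comm] at e0 e1 e2 e3 ⊢
    simp only [e0, e1, e2, e3]
    push_cast
    rcases sg_cases he 0 with h | h
    · rw [h]
      linear_combination (-1) * (D2 + 1 / 2) / 2 * (x 2) * (r3 + r1 - 2 * r2) + ((2 * (1 : ℂ) + 1 - ((n : ℂ) + 2 * j)) / 4 * D2 - (3 * ((n : ℂ) + 2 * j) + 2 * (1 : ℂ) + 3) / 4 * D1) * (x 1) * (r2 - r1) + (-1) * (1 : ℂ) * ((((n : ℂ) + 2 * j) + (1 : ℂ)) + 1) * (D1 - 1 / 2) / 2 * (x 0) * (2 * r1 - r2 - r0)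
    · rw [h]
      linear_combination (1) * (D2 + 1 / 2) / 2 * (x 2) * (r3 + r1 - 2 * r2) + ((2 * (1 : ℂ) + 1 - ((n : ℂ) + 2 * j)) / 4 * D2 - (3 * ((n : ℂ) + 2 * j) + 2 * (1 : ℂ) + 3) / 4 * D1) * (x 1) * (r2 - r1) + (1) * (1 : ℂ) * ((((n : ℂ) + 2 * j) + (1 : ℂ)) + 1) * (D1 - 1 / 2) / 2 * (x 0) * (2 * r1 - r2 - r0)
  · obtain ⟨D0, D1, D2, D3, e0, e1, e2, e3, r0, r1, r2, r3⟩ := qd_param hne lam (a + j + 1 + 1)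
    push_cast at r0 r1 r2 r3
    simp only [Nat.add_assoc, Nat.add_comm, Nat.add_left_comm] at e0 e1 e2 e3 ⊢
    simp only [e0, e1, e2, e3]
    push_cast
    rcases sg_cases he a with h | h
    · rw [h]
      linear_combination (1) * (D2 + 1 / 2) / 2 * (x (((a + 1) + 1) + 1)) * (r3 + r1 - 2 * r2) + ((2 * ((a : ℂ) + 2) + 1 - ((n : ℂ) + 2 * j)) / 4 * D2 - (3 * ((n : ℂ) + 2 * j) + 2 * ((a : ℂ) + 2) + 3) / 4 * D1) * (x ((a + 1) + 1)) * (r2 - r1) + (1) * ((a : ℂ) + 2) * ((((n : ℂ) + 2 * j) + ((a : ℂ) + 2)) + 1) * (D1 - 1 / 2) / 2 * (x (a + 1)) * (2 * r1 - r2 - r0)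
    · rw [h]
      linear_combination (-1) * (D2 + 1 / 2) / 2 * (x (((a + 1) + 1) + 1)) * (r3 + r1 - 2 * r2) + ((2 * ((a : ℂ) + 2) + 1 - ((n : ℂ) + 2 * j)) / 4 * D2 - (3 * ((n : ℂ) + 2 * j) + 2 * ((a : ℂ) + 2) + 3) / 4 * D1) * (x ((a + 1) + 1)) * (r2 - r1) + (-1) * ((a : ℂ) + 2) * ((((n : ℂ) + 2 * j) + ((a : ℂ) + 2)) + 1) * (D1 - 1 / 2) / 2 * (x (a + 1)) * (2 * r1 - r2 - r0)


lemma opT_smul (n : ℕ) (eps lam : ℂ) (j : ℕ) (c : ℂ) (x : ℕ → ℂ) (a : ℕ) :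
    opT n eps lam j (fun a => c * x a) a = c * opT n eps lam j x a := by
  simp only [opT]; ring

lemma opA_smul (n : ℕ) (eps lam : ℂ) (j : ℕ) (c : ℂ) (x : ℕ → ℂ) (a : ℕ) :
    opA n eps lam j (fun a => c * x a) a = c * opA n eps lam j x a := by
  simp only [opA]; ring

lemma opB_smul (n : ℕ) (eps lam : ℂ) (j : ℕ) (c : ℂ) (x : ℕ → ℂ) (a : ℕ) :
    opB n eps lam j (fun a => c * x a) a = c * opB n eps lam j x a := by
  simp only [opB]; ring

lemma opT_sub (n : ℕ) (eps lam : ℂ) (j : ℕ) (x y : ℕ → ℂ) (a : ℕ) :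
    opT n eps lam j (fun a => x a - y a) a = opT n eps lam j x a - opT n eps lam j y a := by
  simp only [opT]; ring

lemma opA_sub (n : ℕ) (eps lam : ℂ) (j : ℕ) (x y : ℕ → ℂ) (a : ℕ) :
    opA n eps lam j (fun a => x a - y a) a = opA n eps lam j x a - opA n eps lam j y a := by
  simp only [opA]; ring

lemma opB_sub (n : ℕ) (eps lam : ℂ) (j : ℕ) (x y : ℕ → ℂ) (a : ℕ) :
    opB n eps lam j (fun a => x a - y a) a = opB n eps lam j x a - opB n eps lam j y a := by
  simp only [opB]; ring

/-- The normalised system: `b j a` corresponds to `s (a + j, j)`. -/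
def IsQ (n : ℕ) (eps lam nu : ℂ) (b : ℕ → ℕ → ℂ) : Prop :=
  (∀ j a, opT n eps lam j (b j) a = nu * b j a) ∧
  (∀ j a, opA n eps lam j (b (j + 1)) a = (nu + mj n j) * b j a) ∧
  (∀ j a, opB n eps lam j (b j) a = (nu - mj n j) * b (j + 1) a)

/-- The scaling of a function of `(i, j)` is a solution. -/
lemma col_zero {n : ℕ} {eps lam nu : ℂ} {j : ℕ} {y : ℕ → ℂ} {N a0 : ℕ}
    (hT : ∀ a, opT n eps lam j y a = nu * y a) (h0 : ∀ a, a ≤ a0 → y a = 0)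
    (hq : ∀ a, a0 ≤ a → a + 1 ≤ N → qd n lam (a + j + 1) + 1 / 2 ≠ 0) :
    ∀ a, a ≤ N → y a = 0 := by
  intro a
  induction a using Nat.strong_induction_on with
  | _ a ih =>
    intro haN
    by_cases ha : a ≤ a0
    · exact h0 a ha
    · obtain ⟨c, rfl⟩ : ∃ c, a = c + 1 := ⟨a - 1, by omega⟩
      have h1 : y c = 0 := ih c (by omega) (by omega)
      have h2 : y (c - 1) = 0 := ih (c - 1) (by omega) (by omega)
      have h3 := hT c
      rw [opT, h1, h2] at h3
      have h4 := hq c (by omega) haN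
      have h5 : (qd n lam (c + j + 1) + 1 / 2) * y (c + 1) = 0 := by linear_combination h3
      exact (mul_eq_zero.mp h5).resolve_left h4

/-- The solution of the `T`-recursion in column `j`, starting in row `K`. -/
noncomputable def ecol (n : ℕ) (eps lam nu : ℂ) (K j : ℕ) : ℕ → ℂ
  | 0 => if K - j = 0 then 1 else 0
  | (a + 1) =>
    if a + 1 < K - j then 0 else if a + 1 = K - j then 1 else
      (nu * ecol n eps lam nu K j a
        - sg eps a * ((n : ℂ) + 2 * j - 1) * (qd n lam (a + j + 1) + qd n lam (a + j)) / 2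
          * ecol n eps lam nu K j a
        - (a : ℂ) * ((n : ℂ) + a + 2 * j - 1) * (qd n lam (a + j) - 1 / 2)
          * ecol n eps lam nu K j (a - 1)) / (qd n lam (a + j + 1) + 1 / 2)
  termination_by a => a
  decreasing_by all_goals omega

lemma ecol_lt (n : ℕ) (eps lam nu : ℂ) (K j a : ℕ) (h : a < K - j) :
    ecol n eps lam nu K j a = 0 := by
  cases a with
  | zero => rw [ecol, if_neg (by omega)]
  | succ a => rw [ecol, if_pos h]

lemma ecol_eq (n : ℕ) (eps lam nu : ℂ) (K j : ℕ) :
    ecol n eps lam nu K j (K - j) = 1 := by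
  rcases h : K - j with _ | a
  · rw [ecol, if_pos h]
  · rw [ecol, if_neg (by omega), if_pos h.symm]

lemma ecol_T {n : ℕ} {eps lam : ℂ} (nu : ℂ) {K : ℕ}
    (hK1 : ∀ i, K < i → qd n lam i + 1 / 2 ≠ 0) (hK0 : 0 < K → qd n lam K = -1 / 2)
    (j a : ℕ) :
    opT n eps lam j (ecol n eps lam nu K j) a = nu * ecol n eps lam nu K j a := by
  rcases lt_trichotomy (a + 1) (K - j) with h | h | h
  · rw [opT, ecol_lt _ _ _ _ _ _ _ h, ecol_lt _ _ _ _ _ _ a (by omega),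
      ecol_lt _ _ _ _ _ _ (a - 1) (by omega)]
    ring
  · rw [opT, ecol_lt _ _ _ _ _ _ a (by omega), ecol_lt _ _ _ _ _ _ (a - 1) (by omega),
      show a + j + 1 = K by omega, hK0 (by omega)]
    ring
  · have h4 := hK1 (a + j + 1) (by omega)
    rw [opT]
    rw [show ecol n eps lam nu K j (a + 1) = (nu * ecol n eps lam nu K j a
        - sg eps a * ((n : ℂ) + 2 * j - 1) * (qd n lam (a + j + 1) + qd n lam (a + j)) / 2
          * ecol n eps lam nu K j a
        - (a : ℂ) * ((n : ℂ) + a + 2 * j - 1) * (qd n lam (a + j) - 1 / 2)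
          * ecol n eps lam nu K j (a - 1)) / (qd n lam (a + j + 1) + 1 / 2) by
      rw [ecol, if_neg (by omega), if_neg (by omega)]]
    rw [mul_div_cancel₀ _ h4]
    ring

lemma col_unique {n : ℕ} {eps lam nu : ℂ} {K : ℕ}
    (hK1 : ∀ i, K < i → qd n lam i + 1 / 2 ≠ 0) (hK0 : 0 < K → qd n lam K = -1 / 2)
    (j : ℕ) {x : ℕ → ℂ} (hT : ∀ a, opT n eps lam j x a = nu * x a)
    (h0 : ∀ a, a < K - j → x a = 0) (a : ℕ) :
    x a = x (K - j) * ecol n eps lam nu K j a := by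
  have key := col_zero (n := n) (eps := eps) (lam := lam) (nu := nu) (j := j) (N := a)
    (a0 := K - j) (y := fun a => x a - x (K - j) * ecol n eps lam nu K j a)
    (by
      intro a
      rw [opT_sub, opT_smul, hT, ecol_T nu hK1 hK0]; ring)
    (by
      intro a ha
      rcases ha.lt_or_eq with h | h
      · simp only [h0 a h, ecol_lt _ _ _ _ _ _ _ h]; ring
      · simp only [h, ecol_eq]; ring)
    (by
      intro a ha _
      exact hK1 _ (by omega)) a le_rfl
  linear_combination key

/-! values of `A` and `B` at the starting points -/

lemma opA_low {n : ℕ} {eps lam : ℂ} {K : ℕ} (hK0 : 0 < K → qd n lam K = -1 / 2) (j : ℕ)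
    {x : ℕ → ℂ} (h0 : ∀ a, a < K - (j + 1) → x a = 0) (a : ℕ) (ha : a < K - j) :
    opA n eps lam j x a = 0 := by
  have h1 : (qd n lam (a + j + 1) + 1 / 2) * x a = 0 := by
    by_cases h : a < K - (j + 1)
    · rw [h0 a h, mul_zero]
    · rw [show a + j + 1 = K by omega, hK0 (by omega)]; ring
  have h2 : (a : ℂ) * x (a - 1) = 0 := by
    rcases a with _ | a
    · simp
    · rw [h0 _ (by omega), mul_zero]
  have h3 : (a : ℂ) * ((a : ℂ) - 1) * x (a - 2) = 0 := by
    rcases a with _ | a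
    · simp
    · rw [h0 _ (by omega), mul_zero]
  rw [opA]
  linear_combination h1 - sg eps a * (qd n lam (a + j) - qd n lam (a + j + 1)) * h2
    + (qd n lam (a + j) - 1 / 2) * h3

lemma opB_low {n : ℕ} {eps lam : ℂ} {K : ℕ} (hK0 : 0 < K → qd n lam K = -1 / 2) (j : ℕ)
    {x : ℕ → ℂ} (h0 : ∀ a, a < K - j → x a = 0) (a : ℕ) (ha : a < K - (j + 1)) :
    opB n eps lam j x a = 0 := by
  have h1 : (qd n lam (a + j + 2) + 1 / 2) * x (a + 2) = 0 := by
    by_cases h : a + 2 < K - j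
    · rw [h0 _ h, mul_zero]
    · rw [show a + j + 2 = K by omega, hK0 (by omega)]; ring
  rw [opB, h0 (a + 1) (by omega), h0 a (by omega)]
  linear_combination h1

lemma opA_start {n : ℕ} (hne : Even n) {eps lam nu : ℂ} {K : ℕ}
    (hK0 : 0 < K → qd n lam K = -1 / 2) (j : ℕ) (hj : j < K)
    {x : ℕ → ℂ} (hT : ∀ a, opT n eps lam (j + 1) x a = nu * x a)
    (h0 : ∀ a, a < K - (j + 1) → x a = 0) :
    opA n eps lam j x (K - j) = (nu - sg eps (K - j) * mj n j) * x (K - (j + 1)) := by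
  obtain ⟨c, rfl⟩ : ∃ c, K = j + 1 + c := ⟨K - (j + 1), by omega⟩
  have hK := hK0 (by omega)
  rw [show j + 1 + c - j = c + 1 by omega, show j + 1 + c - (j + 1) = c by omega] at *
  have h2 : (c : ℂ) * x (c - 1) = 0 := by
    rcases c with _ | a
    · simp
    · rw [h0 _ (by omega), mul_zero]
  have h1 := hT c
  have r0 := qd_mul hne lam (j + 1 + c)
  have r1 := qd_mul hne lam (j + 1 + c + 1)
  rw [opT, show c + (j + 1) + 1 = j + 1 + c + 1 by omega, show c + (j + 1) = j + 1 + c by omega,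
    hK] at h1
  rw [opA, show c + 1 + j + 1 = j + 1 + c + 1 by omega, show c + 1 + j = j + 1 + c by omega,
    show c + 1 - 2 = c - 1 by omega, show c + 1 - 1 = c by omega, sg_succ, hK, mj]
  rw [hK] at r0
  push_cast at *
  linear_combination h1 - sg eps c * x c * (r1 - r0) / 2
    + ((c + 1) * (-1) + (n + c + 2 * (j + 1) - 1)) * h2

lemma opB_start {n : ℕ} (hne : Even n) {eps lam nu : ℂ} {K : ℕ}
    (hK0 : 0 < K → qd n lam K = -1 / 2) (j : ℕ) (hj : j < K)
    {x : ℕ → ℂ} (hT : ∀ a, opT n eps lam j x a = nu * x a)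
    (h0 : ∀ a, a < K - j → x a = 0) :
    opB n eps lam j x (K - (j + 1)) = (nu + sg eps (K - j) * mj n j) * x (K - j) := by
  obtain ⟨c, rfl⟩ : ∃ c, K = j + 1 + c := ⟨K - (j + 1), by omega⟩
  have hK := hK0 (by omega)
  rw [show j + 1 + c - j = c + 1 by omega, show j + 1 + c - (j + 1) = c by omega] at *
  have h2 : x c = 0 := h0 _ (by omega)
  have h1 := hT (c + 1)
  have r0 := qd_mul hne lam (j + 1 + c)
  have r1 := qd_mul hne lam (j + 1 + c + 1)
  rw [opT, show c + 1 + j + 1 = j + 1 + c + 1 by omega, show c + 1 + j = j + 1 + c by omega,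
    hK, sg_succ, show c + 1 - 1 = c by omega, h2] at h1
  rw [opB, show c + j + 2 = j + 1 + c + 1 by omega, show c + j + 1 = j + 1 + c by omega,
    hK, h2, sg_succ, mj]
  rw [hK] at r0
  push_cast at *
  linear_combination h1 - sg eps c * x (c + 1) * (r1 - r0) / 2

lemma opA_start' {n : ℕ} {eps lam : ℂ} (j : ℕ) (x : ℕ → ℂ) :
    opA n eps lam j x 0 = (qd n lam (j + 1) + 1 / 2) * x 0 := by
  rw [opA]; simp

lemma opB_start' {n : ℕ} (hne : Even n) {eps lam nu : ℂ} (he : eps = 1 ∨ eps = -1) (j : ℕ)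
    {x : ℕ → ℂ} (hT : ∀ a, opT n eps lam j x a = nu * x a) :
    (qd n lam (j + 1) + 1 / 2) * opB n eps lam j x 0 = (nu ^ 2 - mj n j ^ 2) * x 0 := by
  have h0 := hT 0
  have h1 := hT 1
  obtain ⟨D0, D1, D2, D3, e0, e1, e2, e3, r0, r1, r2, r3⟩ := qd_param hne lam j
  have hs : sg eps 1 = - sg eps 0 := sg_succ eps 0
  have ss : sg eps 0 * sg eps 0 = 1 := by
    rcases sg_cases he 0 with h | h <;> rw [h] <;> norm_num
  rw [opT] at h0 h1
  rw [opB]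
  rw [show 0 + j + 1 = j + 1 by omega, show 0 + j = j by omega, show 0 + 1 = 1 by omega,
    e0, e1] at h0
  rw [show 1 + j + 1 = j + 1 + 1 by omega, show 1 + j = j + 1 by omega,
    show 1 + 1 = 2 by omega, show 1 - 1 = 0 by omega, hs, e1, e2] at h1
  rw [show 0 + j + 2 = j + 1 + 1 by omega, show 0 + j + 1 = j + 1 by omega,
    show 0 + 1 = 1 by omega, show 0 + 2 = 2 by omega, e1, e2, mj]
  clear e0 e1 e2 e3 hs
  generalize sg eps 0 = t at *
  push_cast at *
  have a0 : ((n : ℂ) + 2 * j - 1) * (D1 + D0) / 2 = lam - D1 := by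
    linear_combination r0 / 2 + r1 / 2
  have a1 : ((n : ℂ) + 2 * j - 1) * (D2 + D1) / 2 = lam - 2 * D2 - D1 := by
    linear_combination r2 / 2 + r1 / 2
  have a2 : ((n : ℂ) + 2 * j + 1) * (D1 - D2) = 2 * D2 := by
    linear_combination r1 - r2
  have hB : (D2 + 1 / 2) * x 2 + t * ((n : ℂ) + 0 + 2 * j + 1) * (D1 - D2) * x 1
      + ((n : ℂ) + 0 + 2 * j) * ((n : ℂ) + 0 + 2 * j + 1) * (D1 - 1 / 2) * x 0
      = (nu + t * (lam - D1)) * x 1 + ((n : ℂ) + 2 * j) ^ 2 * (D1 - 1 / 2) * x 0 := by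
    linear_combination h1 + t * x 1 * a1 + t * x 1 * a2
  have hC : (D1 + 1 / 2) * x 1 = (nu - t * (lam - D1)) * x 0 := by
    linear_combination h0 - t * x 0 * a0
  have hD : ((n : ℂ) + 2 * j) * D1 = lam - D1 := by linear_combination r1
  rw [hB]
  linear_combination (nu + t * (lam - D1)) * hC - (lam - D1) ^ 2 * x 0 * ss
    + (((n : ℂ) + 2 * j) * D1 + (lam - D1)) * x 0 * hD


lemma seq_sol (p q : ℕ → ℂ) (l : ℕ) (hp : ∀ j, j < l → p j ≠ 0) (hq : ∀ j, l ≤ j → q j ≠ 0) :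
    ∃ t : ℕ → ℂ, t l = 1 ∧ (∀ j, p j * t j = q j * t (j + 1)) ∧
      ∀ t' : ℕ → ℂ, (∀ j, p j * t' j = q j * t' (j + 1)) → ∀ j, t' j = t' l * t j := by
  have huniq : ∀ y : ℕ → ℂ, (∀ j, p j * y j = q j * y (j + 1)) → y l = 0 → ∀ j, y j = 0 := by
    intro y hy hl j
    have hup : ∀ d, y (l + d) = 0 := by
      intro d
      induction d with
      | zero => exact hl
      | succ d ih =>
        have := hy (l + d)
        rw [ih, mul_zero] at this
        exact (mul_eq_zero.mp this.symm).resolve_left (hq _ (by omega))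
    have hdn : ∀ d, d ≤ l → y (l - d) = 0 := by
      intro d
      induction d with
      | zero => intro _; exact hl
      | succ d ih =>
        intro hd
        have h1 := hy (l - (d + 1))
        rw [show l - (d + 1) + 1 = l - d by omega, ih (by omega), mul_zero] at h1
        exact (mul_eq_zero.mp h1).resolve_left (hp _ (by omega))
    rcases le_total l j with h | h
    · have := hup (j - l)
      rwa [show l + (j - l) = j by omega] at this
    · have := hdn (l - j) (by omega)
      rwa [show l - (l - j) = j by omega] at this
  obtain ⟨t, ht1, ht2⟩ : ∃ t : ℕ → ℂ, t l = 1 ∧ (∀ j, p j * t j = q j * t (j + 1)) := by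
    refine ⟨fun j => (∏ i ∈ Finset.Ico l j, p i / q i) * (∏ i ∈ Finset.Ico j l, q i / p i),
      by simp, ?_⟩
    intro j
    rcases le_or_gt l j with h | h
    · have hj := hq j h
      simp only [Finset.Ico_eq_empty_of_le h, Finset.Ico_eq_empty_of_le (Nat.le_succ_of_le h),
        Finset.prod_Ico_succ_top h, Finset.prod_empty]
      field_simp
    · have hj := hp j h
      simp only [Finset.Ico_eq_empty_of_le h.le, Finset.Ico_eq_empty_of_le (Nat.succ_le_of_lt h),
        Finset.prod_eq_prod_Ico_succ_bot h, Finset.prod_empty]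
      field_simp
  refine ⟨t, ht1, ht2, ?_⟩
  intro t' ht' j
  have := huniq (fun j => t' j - t' l * t j)
    (fun j => by linear_combination ht' j - t' l * ht2 j) (by simp [ht1]) j
  linear_combination this

lemma opA_ecol {n : ℕ} (hne : Even n) {eps lam : ℂ} (he : eps = 1 ∨ eps = -1) (nu : ℂ) {K : ℕ}
    (hK1 : ∀ i, K < i → qd n lam i + 1 / 2 ≠ 0) (hK0 : 0 < K → qd n lam K = -1 / 2) (j a : ℕ) :
    opA n eps lam j (ecol n eps lam nu K (j + 1)) a
      = opA n eps lam j (ecol n eps lam nu K (j + 1)) (K - j) * ecol n eps lam nu K j a := by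
  refine col_unique hK1 hK0 j (x := opA n eps lam j (ecol n eps lam nu K (j + 1))) ?_ ?_ a
  · intro a
    rw [opT_opA hne he, show opT n eps lam (j + 1) (ecol n eps lam nu K (j + 1))
      = fun a => nu * ecol n eps lam nu K (j + 1) a from
        funext fun a => ecol_T nu hK1 hK0 (j + 1) a, opA_smul]
  · intro a ha
    exact opA_low hK0 j (fun a h => ecol_lt _ _ _ _ _ _ _ h) a ha

lemma opB_ecol {n : ℕ} (hne : Even n) {eps lam : ℂ} (he : eps = 1 ∨ eps = -1) (nu : ℂ) {K : ℕ}
    (hK1 : ∀ i, K < i → qd n lam i + 1 / 2 ≠ 0) (hK0 : 0 < K → qd n lam K = -1 / 2) (j a : ℕ) :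
    opB n eps lam j (ecol n eps lam nu K j) a
      = opB n eps lam j (ecol n eps lam nu K j) (K - (j + 1))
        * ecol n eps lam nu K (j + 1) a := by
  refine col_unique hK1 hK0 (j + 1) (x := opB n eps lam j (ecol n eps lam nu K j)) ?_ ?_ a
  · intro a
    rw [opT_opB hne he, show opT n eps lam j (ecol n eps lam nu K j)
      = fun a => nu * ecol n eps lam nu K j a from
        funext fun a => ecol_T nu hK1 hK0 j a, opB_smul]
  · intro a ha
    exact opB_low hK0 j (fun a h => ecol_lt _ _ _ _ _ _ _ h) a ha

lemma isQ_ecol_iff {n : ℕ} (hne : Even n) {eps lam : ℂ} (he : eps = 1 ∨ eps = -1) (nu : ℂ)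
    {K : ℕ} (hK1 : ∀ i, K < i → qd n lam i + 1 / 2 ≠ 0) (hK0 : 0 < K → qd n lam K = -1 / 2)
    (t : ℕ → ℂ) :
    IsQ n eps lam nu (fun j a => t j * ecol n eps lam nu K j a) ↔
      ∀ j, (t (j + 1) * opA n eps lam j (ecol n eps lam nu K (j + 1)) (K - j)
          = (nu + mj n j) * t j) ∧
        (t j * opB n eps lam j (ecol n eps lam nu K j) (K - (j + 1))
          = (nu - mj n j) * t (j + 1)) := by
  constructor
  · rintro ⟨_, hA, hB⟩ j
    constructor
    · have := hA j (K - j)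
      simp only [opA_smul, ecol_eq, mul_one] at this
      exact this
    · have := hB j (K - (j + 1))
      simp only [opB_smul, ecol_eq, mul_one] at this
      exact this
  · intro h
    refine ⟨fun j a => ?_, fun j a => ?_, fun j a => ?_⟩
    · rw [opT_smul, ecol_T nu hK1 hK0]; ring
    · rw [opA_smul, opA_ecol hne he nu hK1 hK0]
      linear_combination (ecol n eps lam nu K j a) * (h j).1
    · rw [opB_smul, opB_ecol hne he nu hK1 hK0]
      linear_combination (ecol n eps lam nu K (j + 1) a) * (h j).2

lemma mj_add_ne {n : ℕ} (hn : 0 < n) (i j : ℕ) : mj n i + mj n j ≠ 0 := by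
  unfold mj
  have h : ((n + i + j : ℕ) : ℂ) ≠ 0 := by
    rw [Nat.cast_ne_zero]; omega
  push_cast at h
  intro h'; apply h; linear_combination h'

lemma mj_ne {n : ℕ} (hn : 0 < n) (j : ℕ) : mj n j ≠ 0 := by
  have := mj_add_ne hn j j
  intro h; apply this; rw [h, add_zero]

theorem exists_u {n : ℕ} (hn : 0 < n) (hne : Even n) {eps lam : ℂ} (he : eps = 1 ∨ eps = -1)
    (nu : ℂ) {K : ℕ} (hK1 : ∀ i, K < i → qd n lam i + 1 / 2 ≠ 0)
    (hK0 : 0 < K → qd n lam K = -1 / 2) :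
    ∃ u : ℕ → ℕ → ℂ, IsQ n eps lam nu u ∧ (∀ j a, a + j < K → u j a = 0) ∧
      (∃ j a, u j a ≠ 0) ∧
      ∀ b, IsQ n eps lam nu b → (∀ j a, a + j < K → b j a = 0) →
        ∃ c, ∀ j a, b j a = c * u j a := by
  classical
  set p : ℕ → ℂ := fun j => if j < K ∧ sg eps (K - j) = -1 then 1 else nu + mj n j with hp
  set q : ℕ → ℂ := fun j => if j < K then (if sg eps (K - j) = -1 then 1 else nu - mj n j)
    else qd n lam (j + 1) + 1 / 2 with hq
  have key : ∀ t : ℕ → ℂ, IsQ n eps lam nu (fun j a => t j * ecol n eps lam nu K j a) ↔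
      ∀ j, p j * t j = q j * t (j + 1) := by
    intro t
    rw [isQ_ecol_iff hne he nu hK1 hK0]
    refine forall_congr' fun j => ?_
    by_cases hj : j < K
    · rw [opA_start hne hK0 j hj (fun a => ecol_T nu hK1 hK0 (j + 1) a)
        (fun a h => ecol_lt _ _ _ _ _ _ _ h),
        opB_start hne hK0 j hj (fun a => ecol_T nu hK1 hK0 j a)
        (fun a h => ecol_lt _ _ _ _ _ _ _ h), ecol_eq, ecol_eq]
      rcases sg_cases he (K - j) with hs | hs
      · have h1 : (1 : ℂ) ≠ -1 := by norm_num
        simp only [hp, hq, hj, hs, h1, if_true, and_false, if_false]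
        constructor
        · rintro ⟨h1, h2⟩
          linear_combination -h1
        · intro h
          exact ⟨by linear_combination -h, by linear_combination h⟩
      · simp only [hp, hq, hj, hs, if_true, and_self]
        constructor
        · rintro ⟨h1, h2⟩
          have h3 : mj n j * (t j - t (j + 1)) = 0 := by linear_combination -h1 / 2 - h2 / 2
          have h4 := (mul_eq_zero.mp h3).resolve_left (mj_ne hn j)
          linear_combination h4
        · intro h
          exact ⟨by linear_combination -(nu + mj n j) * h, by linear_combination (nu - mj n j) * h⟩
    · rw [show K - j = 0 by omega, show K - (j + 1) = 0 by omega, opA_start']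
      have hB := opB_start' hne he j (fun a => ecol_T (n := n) (eps := eps) nu hK1 hK0 j a)
      have e1 := ecol_eq n eps lam nu K j
      have e2 := ecol_eq n eps lam nu K (j + 1)
      rw [show K - j = 0 by omega] at e1
      rw [show K - (j + 1) = 0 by omega] at e2
      rw [e1] at hB
      rw [e2]
      have hne0 := hK1 (j + 1) (by omega)
      simp only [hp, hq, hj, false_and, if_false]
      constructor
      · rintro ⟨h1, h2⟩
        linear_combination -h1
      · intro h
        refine ⟨by linear_combination -h, ?_⟩
        apply mul_left_cancel₀ hne0
        linear_combination t j * hB + (nu - mj n j) * h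
  obtain ⟨l, hl1, hl2⟩ : ∃ l, (∀ j, j < l → p j ≠ 0) ∧ (∀ j, l ≤ j → q j ≠ 0) := by
    by_cases hex : ∃ j0, j0 < K ∧ nu = mj n j0
    · obtain ⟨j0, hj0, hnu⟩ := hex
      refine ⟨K, fun j hj => ?_, fun j hj => ?_⟩
      · simp only [hp]
        split_ifs
        · exact one_ne_zero
        · rw [hnu]; exact mj_add_ne hn j0 j
      · simp only [hq, if_neg (not_lt.mpr hj)]
        exact hK1 _ (by omega)
    · refine ⟨0, fun j hj => absurd hj (by omega), fun j _ => ?_⟩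
      simp only [hq]
      split_ifs with h1 h2
      · exact one_ne_zero
      · intro h3
        exact hex ⟨j, h1, by linear_combination h3⟩
      · exact hK1 _ (by omega)
  obtain ⟨t, ht1, ht2, ht3⟩ := seq_sol p q l hl1 hl2
  refine ⟨fun j a => t j * ecol n eps lam nu K j a, (key t).mpr ht2, ?_, ?_, ?_⟩
  · intro j a h
    simp only [ecol_lt n eps lam nu K j a (by omega), mul_zero]
  · exact ⟨l, K - l, by simp [ht1, ecol_eq]⟩
  · intro b hb hb0
    have hcol : b = fun j a => b j (K - j) * ecol n eps lam nu K j a := by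
      funext j a
      exact col_unique hK1 hK0 j (hb.1 j) (fun a h => hb0 j a (by omega)) a
    have hrec := (key (fun j => b j (K - j))).mp (by rw [← hcol]; exact hb)
    refine ⟨b l (K - l), fun j a => ?_⟩
    have h1 := ht3 _ hrec j
    have h2 : b j a = b j (K - j) * ecol n eps lam nu K j a := congrFun (congrFun hcol j) a
    rw [h2, h1, mul_assoc]


/-! ### Classification of the solutions of the normalised system -/

lemma IsQ.comb {n : ℕ} {eps lam nu : ℂ} {b w : ℕ → ℕ → ℂ} (hb : IsQ n eps lam nu b)
    (hw : IsQ n eps lam nu w) (c : ℂ) : IsQ n eps lam nu (fun j a => b j a - c * w j a) := by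
  refine ⟨fun j a => ?_, fun j a => ?_, fun j a => ?_⟩
  · rw [opT_sub, opT_smul, hb.1, hw.1]; ring
  · rw [opA_sub, opA_smul, hb.2.1, hw.2.1]; ring
  · rw [opB_sub, opB_smul, hb.2.2, hw.2.2]; ring

/-- The solution space is spanned by one nonzero solution. -/
def Dim1 (n : ℕ) (eps lam nu : ℂ) : Prop :=
  ∃ u : ℕ → ℕ → ℂ, IsQ n eps lam nu u ∧ (∃ j a, u j a ≠ 0) ∧
    ∀ b, IsQ n eps lam nu b → ∃ c, ∀ j a, b j a = c * u j a

/-- The solution space is spanned by two independent solutions. -/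
def Dim2 (n : ℕ) (eps lam nu : ℂ) : Prop :=
  ∃ u w : ℕ → ℕ → ℂ, IsQ n eps lam nu u ∧ IsQ n eps lam nu w ∧ (∃ j a, u j a ≠ 0) ∧
    u 0 0 = 0 ∧ w 0 0 ≠ 0 ∧
    ∀ b, IsQ n eps lam nu b → ∃ c d, ∀ j a, b j a = c * u j a + d * w j a

lemma qd_half {n : ℕ} (hne : Even n) {lam : ℂ} {k : ℕ} (hk : lam = -((n : ℂ) / 2) - 1 / 2 - k)
    (i : ℕ) : (qd n lam i + 1 / 2) * ((n : ℂ) + 2 * i - 1) = (i : ℂ) - (k + 1) := by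
  have := qd_mul hne lam i
  linear_combination this + hk

lemma qd_half' {n : ℕ} (hne : Even n) {lam : ℂ} {k : ℕ} (hk : lam = -((n : ℂ) / 2) - 1 / 2 - k)
    (i : ℕ) : (1 / 2 - qd n lam i) * ((n : ℂ) + 2 * i - 1) = (n : ℂ) + i + k := by
  have := qd_mul hne lam i
  linear_combination -this - hk

lemma qd_special {n : ℕ} (hne : Even n) {lam : ℂ} {k : ℕ}
    (hk : lam = -((n : ℂ) / 2) - 1 / 2 - k) : qd n lam (k + 1) = -1 / 2 := by
  have h := qd_half hne hk (k + 1)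
  have h2 := den_ne hne (k + 1)
  push_cast at h h2
  rw [sub_self] at h
  have := (mul_eq_zero.mp h).resolve_right h2
  linear_combination this

lemma qd_special_ne {n : ℕ} (hne : Even n) {lam : ℂ} {k : ℕ}
    (hk : lam = -((n : ℂ) / 2) - 1 / 2 - k) {i : ℕ} (hi : i ≠ k + 1) :
    qd n lam i + 1 / 2 ≠ 0 := by
  intro h0
  have h := qd_half hne hk i
  rw [h0, zero_mul] at h
  apply hi
  have : (i : ℂ) = ((k + 1 : ℕ) : ℂ) := by push_cast; linear_combination -h
  exact_mod_cast this

lemma qd_special_ne' {n : ℕ} (hn : 0 < n) (hne : Even n) {lam : ℂ} {k : ℕ}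
    (hk : lam = -((n : ℂ) / 2) - 1 / 2 - k) (i : ℕ) :
    1 / 2 - qd n lam i ≠ 0 := by
  intro h0
  have h := qd_half' hne hk i
  rw [h0, zero_mul] at h
  have : ((n + i + k : ℕ) : ℂ) = 0 := by push_cast; exact h.symm
  have : n + i + k = 0 := by exact_mod_cast this
  omega

lemma dim1_generic {n : ℕ} (hn : 0 < n) (hne : Even n) {eps lam : ℂ} (he : eps = 1 ∨ eps = -1)
    (nu : ℂ) (hlam : ∀ k : ℕ, lam ≠ -((n : ℂ) / 2) - 1 / 2 - k) : Dim1 n eps lam nu := by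
  obtain ⟨u, h1, -, h3, h4⟩ := exists_u (K := 0) hn hne he nu (lam := lam) (by
    intro i hi h0
    obtain ⟨k, rfl⟩ : ∃ k, i = k + 1 := ⟨i - 1, by omega⟩
    apply hlam k
    have := qd_mul hne lam (k + 1)
    push_cast at this
    linear_combination -this + ((n : ℂ) + 2 * (k + 1) - 1) * h0) (by omega)
  exact ⟨u, h1, h3, fun b hb => h4 b hb (fun j a h => absurd h (by omega))⟩

lemma IsQ.A0 {n : ℕ} {eps lam nu : ℂ} {b : ℕ → ℕ → ℂ} (hb : IsQ n eps lam nu b) (j : ℕ) :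
    (qd n lam (j + 1) + 1 / 2) * b (j + 1) 0 = (nu + mj n j) * b j 0 := by
  have := hb.2.1 j 0
  rwa [opA_start'] at this

lemma IsQ.back {n : ℕ} {eps lam nu : ℂ} {b : ℕ → ℕ → ℂ} (hb : IsQ n eps lam nu b) {l0 l1 : ℕ}
    (h1 : (qd n lam l1 + 1 / 2) * b l1 0 = 0)
    (hnu : ∀ j, l0 ≤ j → j < l1 → nu + mj n j ≠ 0) :
    ∀ j, l0 ≤ j → j < l1 → b j 0 = 0 := by
  have hd : ∀ d j, j + d + 1 = l1 → l0 ≤ j → b j 0 = 0 := by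
    intro d
    induction d with
    | zero =>
      intro j hj hl
      have h := hb.A0 j
      rw [show j + 1 = l1 by omega, h1] at h
      exact (mul_eq_zero.mp h.symm).resolve_left (hnu j hl (by omega))
    | succ d ih =>
      intro j hj hl
      have h := hb.A0 j
      rw [ih (j + 1) (by omega) (by omega), mul_zero] at h
      exact (mul_eq_zero.mp h.symm).resolve_left (hnu j hl (by omega))
  intro j h0 hj
  exact hd (l1 - j - 1) j (by omega) h0

lemma IsQ.col_low {n : ℕ} (hne : Even n) {eps lam nu : ℂ} {k : ℕ}
    (hk : lam = -((n : ℂ) / 2) - 1 / 2 - k) {b : ℕ → ℕ → ℂ} (hb : IsQ n eps lam nu b)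
    {j : ℕ} (h0 : b j 0 = 0) {a : ℕ} (ha : a + j < k + 1) : b j a = 0 := by
  refine col_zero (N := k - j) (a0 := 0) (hb.1 j) ?_ ?_ a (by omega)
  · intro a ha; rw [show a = 0 by omega, h0]
  · intro a _ h
    exact qd_special_ne hne hk (by omega)

lemma IsQ.low {n : ℕ} (hne : Even n) {eps lam nu : ℂ} {k : ℕ}
    (hk : lam = -((n : ℂ) / 2) - 1 / 2 - k) {b : ℕ → ℕ → ℂ} (hb : IsQ n eps lam nu b)
    (h00 : b 0 0 = 0) : ∀ j a, a + j < k + 1 → b j a = 0 := by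
  have h1 : ∀ j, j ≤ k → b j 0 = 0 := by
    intro j
    induction j with
    | zero => intro _; exact h00
    | succ j ih =>
      intro hj
      have h := hb.A0 j
      rw [ih (by omega), mul_zero] at h
      exact (mul_eq_zero.mp h).resolve_left (qd_special_ne hne hk (by omega))
  intro j a ha
  exact hb.col_low hne hk (h1 j (by omega)) ha

lemma dim1_of_zero {n : ℕ} (hn : 0 < n) (hne : Even n) {eps lam nu : ℂ}
    (he : eps = 1 ∨ eps = -1) {k : ℕ} (hk : lam = -((n : ℂ) / 2) - 1 / 2 - k)
    (h : ∀ b, IsQ n eps lam nu b → b 0 0 = 0) : Dim1 n eps lam nu := by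
  obtain ⟨u, h1, -, h3, h4⟩ := exists_u (K := k + 1) hn hne he nu (lam := lam)
    (fun i hi => qd_special_ne hne hk (by omega)) (fun _ => qd_special hne hk)
  exact ⟨u, h1, h3, fun b hb => h4 b hb (hb.low hne hk (h b hb))⟩

lemma dim1_nu {n : ℕ} (hn : 0 < n) (hne : Even n) {eps lam nu : ℂ}
    (he : eps = 1 ∨ eps = -1) {k : ℕ} (hk : lam = -((n : ℂ) / 2) - 1 / 2 - k)
    (hnu : ∀ l, l ≤ k → nu ≠ -mj n l) : Dim1 n eps lam nu := by
  refine dim1_of_zero hn hne he hk fun b hb => ?_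
  refine hb.back (l0 := 0) (l1 := k + 1) (by rw [qd_special hne hk]; ring) ?_ 0 le_rfl (by omega)
  intro j _ hj h
  exact hnu j (by omega) (by linear_combination h)

lemma nu_add_ne {n : ℕ} {nu : ℂ} {l : ℕ} (hnu : nu = -mj n l) {j : ℕ} (hj : j ≠ l) :
    nu + mj n j ≠ 0 := by
  intro h
  apply hj
  rw [hnu] at h
  unfold mj at h
  have : (j : ℂ) = (l : ℂ) := by linear_combination h
  exact_mod_cast this

lemma qd_two {n : ℕ} (hne : Even n) (lam : ℂ) (l a : ℕ) :
    ((n : ℂ) + 2 * l - 1) * (qd n lam (a + 1 + l + 1) + qd n lam (a + 1 + l)) / 2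
      + (a + 1) * (qd n lam (a + 1 + l) - qd n lam (a + 1 + l + 1))
      = ((n : ℂ) + 2 * l) * qd n lam (a + 1 + l + 1) := by
  have h1 := qd_mul hne lam (a + 1 + l)
  have h2 := qd_mul hne lam (a + 1 + l + 1)
  push_cast at h1 h2
  linear_combination h1 / 2 - h2 / 2

lemma qd_two0 {n : ℕ} (hne : Even n) (lam : ℂ) (l : ℕ) :
    ((n : ℂ) + 2 * l - 1) * (qd n lam (l + 1) + qd n lam l) / 2
      = ((n : ℂ) + 2 * l) * qd n lam (l + 1) := by
  have h1 := qd_mul hne lam l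
  have h2 := qd_mul hne lam (l + 1)
  push_cast at h1 h2
  linear_combination h1 / 2 - h2 / 2

lemma dim1_wrong {n : ℕ} (hn : 0 < n) (hne : Even n) {eps lam nu : ℂ}
    (he : eps = 1 ∨ eps = -1) {k l : ℕ} (hlk : l ≤ k) (hk : lam = -((n : ℂ) / 2) - 1 / 2 - k)
    (hnu : nu = -mj n l) (hs : sg eps (k - l) = -1) : Dim1 n eps lam nu := by
  refine dim1_of_zero hn hne he hk fun b hb => ?_
  have hup := hb.back (l0 := l + 1) (l1 := k + 1) (by rw [qd_special hne hk]; ring)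
    (fun j h1 _ => nu_add_ne hnu (by omega))
  have hz : ∀ a, a + (l + 1) < k + 1 → b (l + 1) a = 0 := fun a ha =>
    hb.col_low hne hk (hup (l + 1) le_rfl (by omega)) ha
  have hP : ∀ a, a + l ≤ k → (qd n lam (a + l + 1) + 1 / 2) * b l (a + 1)
      = -((n : ℂ) + a + 2 * l) * (1 / 2 + sg eps a * qd n lam (a + l + 1)) * b l a := by
    intro a ha
    rcases a with _ | a
    · have hT := hb.1 l 0
      have h2 := qd_two0 hne lam l
      rw [opT, hnu, mj] at hT
      simp only [Nat.zero_add] at hT ⊢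
      push_cast at hT ⊢
      linear_combination hT - sg eps 0 * b l 0 * h2
    · have hT := hb.1 l (a + 1)
      have hB := hb.2.2 l a
      have h2 := qd_two hne lam l a
      rw [hz a (by omega), mul_zero] at hB
      rw [opT, hnu, mj, sg_succ] at hT
      rw [opB] at hB
      rw [sg_succ]
      have hnz : (n : ℂ) + 2 * l ≠ 0 := by
        have := mj_add_ne hn l l
        unfold mj at this
        intro h; apply this; linear_combination h
      apply mul_left_cancel₀ hnz
      rw [show a + l + 2 = a + 1 + l + 1 by omega, show a + l + 1 = a + 1 + l by omega] at hB
      rw [show a + 1 - 1 = a by omega] at hT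
      push_cast at *
      linear_combination ((n : ℂ) + a + 2 * l + 1) * hT - (a + 1) * hB
        + ((n : ℂ) + a + 2 * l + 1) * sg eps a * b l (a + 1) * h2
  have hdn : ∀ d a, a + l + d = k → b l a = 0 := by
    intro d
    induction d with
    | zero =>
      intro a ha
      have h := hP a (by omega)
      rw [show a = k - l by omega, hs, show k - l + l + 1 = k + 1 by omega,
        qd_special hne hk] at h
      rw [show a = k - l by omega]
      have hnz : (n : ℂ) + ((k - l : ℕ) : ℂ) + 2 * l ≠ 0 := by
        have : ((n + (k - l) + 2 * l : ℕ) : ℂ) ≠ 0 := by rw [Nat.cast_ne_zero]; omega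
        push_cast at this; exact this
      apply mul_left_cancel₀ hnz
      linear_combination h
    | succ d ih =>
      intro a ha
      have h := hP a (by omega)
      rw [ih (a + 1) (by omega), mul_zero] at h
      have hnz : (n : ℂ) + a + 2 * l ≠ 0 := by
        have : ((n + a + 2 * l : ℕ) : ℂ) ≠ 0 := by rw [Nat.cast_ne_zero]; omega
        push_cast at this; exact this
      have hnz2 : 1 / 2 + sg eps a * qd n lam (a + l + 1) ≠ 0 := by
        rcases sg_cases he a with h' | h' <;> rw [h']
        · have := qd_special_ne hne hk (i := a + l + 1) (by omega)
          intro h; apply this; linear_combination h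
        · have := qd_special_ne' hn hne hk (a + l + 1)
          intro h; apply this; linear_combination h
      exact (mul_eq_zero.mp h.symm).resolve_left (mul_ne_zero (neg_ne_zero.mpr hnz) hnz2)
  have hl0 : b l 0 = 0 := hdn (k - l) 0 (by omega)
  rcases Nat.eq_zero_or_pos l with h | h
  · rw [h] at hl0; exact hl0
  · exact hb.back (l0 := 0) (l1 := l) (by rw [hl0, mul_zero])
      (fun j _ hj => nu_add_ne hnu (by omega)) 0 le_rfl h

/-- Column `l` of the exceptional solution. -/
noncomputable def wcol (n : ℕ) (eps lam : ℂ) (l : ℕ) : ℕ → ℂ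
  | 0 => 1
  | (a + 1) => -((n : ℂ) + a + 2 * l) * (if sg eps a = 1 then 1 else
      (1 / 2 - qd n lam (a + l + 1)) / (1 / 2 + qd n lam (a + l + 1))) * wcol n eps lam l a

lemma wcol_spec {n : ℕ} (hne : Even n) {eps lam : ℂ} (he : eps = 1 ∨ eps = -1) {k l : ℕ}
    (hk : lam = -((n : ℂ) / 2) - 1 / 2 - k) (hs : sg eps (k - l) = 1) (a : ℕ) :
    (qd n lam (a + l + 1) + 1 / 2) * wcol n eps lam l (a + 1)
      = -((n : ℂ) + a + 2 * l) * (1 / 2 + sg eps a * qd n lam (a + l + 1)) * wcol n eps lam l a ∧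
    ((n : ℂ) + a + 2 * l) * (qd n lam (a + l + 1) - 1 / 2) * wcol n eps lam l a
      = (1 / 2 - sg eps a * qd n lam (a + l + 1)) * wcol n eps lam l (a + 1) := by
  rw [wcol]
  rcases sg_cases he a with h | h
  · rw [if_pos h, h]
    constructor <;> ring
  · have h1 : ¬ sg eps a = 1 := by rw [h]; norm_num
    have h2 : 1 / 2 + qd n lam (a + l + 1) ≠ 0 := by
      have := qd_special_ne hne hk (i := a + l + 1) (by
        intro h3
        rw [show k - l = a by omega] at hs
        exact h1 hs)
      intro h; apply this; linear_combination h
    rw [if_neg h1, h]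
    generalize qd n lam (a + l + 1) = D at *
    constructor
    · rw [show D + 1 / 2 = 1 / 2 + D by ring]
      rw [mul_div_assoc', div_mul_eq_mul_div, mul_div_cancel₀ _ h2]
      ring
    · rw [show (1 : ℂ) / 2 - -1 * D = 1 / 2 + D by ring]
      rw [mul_div_assoc', div_mul_eq_mul_div, mul_div_cancel₀ _ h2]
      ring

lemma wcol_T {n : ℕ} (hne : Even n) {eps lam nu : ℂ} (he : eps = 1 ∨ eps = -1) {k l : ℕ}
    (hk : lam = -((n : ℂ) / 2) - 1 / 2 - k) (hs : sg eps (k - l) = 1) (hnu : nu = -mj n l)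
    (a : ℕ) : opT n eps lam l (wcol n eps lam l) a = nu * wcol n eps lam l a := by
  rw [opT, hnu, mj]
  rcases a with _ | a
  · have h1 := (wcol_spec hne he hk hs 0).1
    have h2 := qd_two0 hne lam l
    simp only [Nat.zero_add] at h1 ⊢
    push_cast at h1 ⊢
    linear_combination h1 + sg eps 0 * wcol n eps lam l 0 * h2
  · have h1 := (wcol_spec hne he hk hs (a + 1)).1
    have h3 := (wcol_spec hne he hk hs a).2
    have h2 := qd_two hne lam l a
    rw [sg_succ] at *
    rw [show a + l + 1 = a + 1 + l by omega] at h3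
    rw [show a + 1 - 1 = a by omega]
    push_cast at *
    linear_combination h1 + (a + 1) * h3 - sg eps a * wcol n eps lam l (a + 1) * h2

lemma wcol_B {n : ℕ} (hne : Even n) {eps lam : ℂ} (he : eps = 1 ∨ eps = -1) {k l : ℕ}
    (hk : lam = -((n : ℂ) / 2) - 1 / 2 - k) (hs : sg eps (k - l) = 1)
    (a : ℕ) : opB n eps lam l (wcol n eps lam l) a = 0 := by
  have h1 := (wcol_spec hne he hk hs (a + 1)).1
  have h3 := (wcol_spec hne he hk hs a).2
  rw [sg_succ] at h1
  rw [opB, show a + l + 2 = a + 1 + l + 1 by omega, show a + 2 = a + 1 + 1 by omega]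
  rw [show a + l + 1 = a + 1 + l by omega] at *
  push_cast at *
  linear_combination h1 + ((n : ℂ) + a + 2 * l + 1) * h3

/-- The columns below `l` of the exceptional solution; `d = l - j`. -/
noncomputable def wdown (n : ℕ) (eps lam nu : ℂ) (l : ℕ) : ℕ → ℕ → ℂ
  | 0 => wcol n eps lam l
  | (d + 1) => fun a => (nu + mj n (l - (d + 1)))⁻¹ *
      opA n eps lam (l - (d + 1)) (wdown n eps lam nu l d) a

lemma exists_w {n : ℕ} (hne : Even n) {eps lam nu : ℂ}
    (he : eps = 1 ∨ eps = -1) {k l : ℕ} (hlk : l ≤ k) (hk : lam = -((n : ℂ) / 2) - 1 / 2 - k)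
    (hnu : nu = -mj n l) (hs : sg eps (k - l) = 1) :
    ∃ w, IsQ n eps lam nu w ∧ w 0 0 ≠ 0 := by
  have hT : ∀ d, d ≤ l → ∀ a, opT n eps lam (l - d) (wdown n eps lam nu l d) a
      = nu * wdown n eps lam nu l d a := by
    intro d
    induction d with
    | zero => intro _ a; exact wcol_T hne he hk hs hnu a
    | succ d ih =>
      intro hd a
      rw [wdown, opT_smul]
      have h1 : opT n eps lam (l - (d + 1) + 1) (wdown n eps lam nu l d)
          = fun a => nu * wdown n eps lam nu l d a := by
        rw [show l - (d + 1) + 1 = l - d by omega]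
        exact funext (ih (by omega))
      rw [show opT n eps lam (l - (d + 1)) (fun a => opA n eps lam (l - (d + 1))
        (wdown n eps lam nu l d) a) a = opT n eps lam (l - (d + 1)) (opA n eps lam (l - (d + 1))
        (wdown n eps lam nu l d)) a from rfl, opT_opA hne he, h1, opA_smul]
      ring
  have h0 : ∀ d, d ≤ l → wdown n eps lam nu l d 0 ≠ 0 := by
    intro d
    induction d with
    | zero => intro _; rw [wdown, wcol]; exact one_ne_zero
    | succ d ih =>
      intro hd
      rw [wdown]
      simp only [opA_start']
      refine mul_ne_zero (inv_ne_zero (nu_add_ne hnu (by omega))) (mul_ne_zero ?_ (ih (by omega)))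
      exact qd_special_ne hne hk (by omega)
  refine ⟨fun j a => if j ≤ l then wdown n eps lam nu l (l - j) a else 0, ⟨?_, ?_, ?_⟩, ?_⟩
  · intro j a
    by_cases hj : j ≤ l
    · simp only [hj, if_true]
      have := hT (l - j) (by omega) a
      rwa [show l - (l - j) = j by omega] at this
    · simp only [hj, if_false, opT]; ring
  · intro j a
    by_cases hj : j + 1 ≤ l
    · simp only [hj, if_true, show j ≤ l by omega]
      obtain ⟨d, hd⟩ : ∃ d, l - j = d + 1 := ⟨l - j - 1, by omega⟩
      have hne0 := nu_add_ne hnu (j := j) (by omega)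
      rw [hd, show l - (j + 1) = d by omega, wdown, show l - (d + 1) = j by omega,
        mul_inv_cancel_left₀ hne0]
    · by_cases hj' : j = l
      · rw [hj', hnu]
        simp [opA]
      · simp [hj, show ¬ j ≤ l by omega, opA]
  · intro j a
    by_cases hj : j + 1 ≤ l
    · simp only [hj, if_true, show j ≤ l by omega]
      obtain ⟨d, hd⟩ : ∃ d, l - j = d + 1 := ⟨l - j - 1, by omega⟩
      have hne0 := nu_add_ne hnu (j := j) (by omega)
      rw [hd, show l - (j + 1) = d by omega, wdown, show l - (d + 1) = j by omega, opB_smul]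
      have h1 : opT n eps lam (j + 1) (wdown n eps lam nu l d)
          = fun a => nu * wdown n eps lam nu l d a := by
        rw [show j + 1 = l - d by omega]
        exact funext (hT d (by omega))
      rw [show opB n eps lam j (fun a => opA n eps lam j
        (wdown n eps lam nu l d) a) a = opB n eps lam j (opA n eps lam j
        (wdown n eps lam nu l d)) a from rfl, opB_opA hne he, h1, opT_smul, h1]
      apply mul_left_cancel₀ hne0
      rw [mul_inv_cancel_left₀ hne0]
      ring
    · by_cases hj' : j = l
      · rw [hj']
        have := wcol_B hne he hk hs a
        simpa [wdown] using this
      · simp [hj, show ¬ j ≤ l by omega, opB]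
  · simpa using h0 l le_rfl

lemma dim2_right {n : ℕ} (hn : 0 < n) (hne : Even n) {eps lam nu : ℂ}
    (he : eps = 1 ∨ eps = -1) {k l : ℕ} (hlk : l ≤ k) (hk : lam = -((n : ℂ) / 2) - 1 / 2 - k)
    (hnu : nu = -mj n l) (hs : sg eps (k - l) = 1) : Dim2 n eps lam nu := by
  obtain ⟨u, h1, h2, h3, h4⟩ := exists_u (K := k + 1) hn hne he nu (lam := lam)
    (fun i hi => qd_special_ne hne hk (by omega)) (fun _ => qd_special hne hk)
  obtain ⟨w, hw, hw0⟩ := exists_w hne he hlk hk hnu hs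
  refine ⟨u, w, h1, hw, h3, h2 0 0 (by omega), hw0, fun b hb => ?_⟩
  have hb' := hb.comb hw (b 0 0 / w 0 0)
  obtain ⟨c, hc⟩ := h4 _ hb' (hb'.low hne hk (by rw [div_mul_cancel₀ _ hw0, sub_self]))
  exact ⟨c, b 0 0 / w 0 0, fun j a => by linear_combination hc j a⟩


/-! ### Transfer to the original system -/

noncomputable def kap (a : ℕ) : ℂ := Complex.I ^ a / (a.factorial : ℂ)

noncomputable def gj (n j : ℕ) : ℂ := ∏ i ∈ Finset.range j, ((n : ℂ) + 2 * i - 1)⁻¹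

lemma kap_ne (a : ℕ) : kap a ≠ 0 := by
  unfold kap
  exact div_ne_zero (pow_ne_zero _ Complex.I_ne_zero) (by exact_mod_cast a.factorial_ne_zero)

lemma kap_succ (a : ℕ) : ((a : ℂ) + 1) * kap (a + 1) = Complex.I * kap a := by
  unfold kap
  have h1 : (a : ℂ) + 1 ≠ 0 := by exact_mod_cast Nat.succ_ne_zero a
  have h2 : (a.factorial : ℂ) ≠ 0 := by exact_mod_cast a.factorial_ne_zero
  rw [Nat.factorial_succ, pow_succ]
  push_cast
  field_simp

lemma gj_ne {n : ℕ} (hne : Even n) (j : ℕ) : gj n j ≠ 0 := by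
  unfold gj
  exact Finset.prod_ne_zero_iff.mpr fun i _ => inv_ne_zero (den_ne hne i)

lemma gj_succ {n : ℕ} (hne : Even n) (j : ℕ) :
    gj n j = ((n : ℂ) + 2 * j - 1) * gj n (j + 1) := by
  unfold gj
  rw [Finset.prod_range_succ, mul_comm, mul_assoc, inv_mul_cancel₀ (den_ne hne j), mul_one]

noncomputable def phi (n : ℕ) (b : ℕ → ℕ → ℂ) : ℕ × ℕ → ℂ :=
  fun p => if p.2 ≤ p.1 then kap (p.1 - p.2) * gj n p.2 * b p.2 (p.1 - p.2) else 0

lemma phi_apply (n : ℕ) (b : ℕ → ℕ → ℂ) (a j : ℕ) :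
    phi n b (a + j, j) = kap a * gj n j * b j a := by
  unfold phi
  rw [if_pos (by simp)]
  simp

lemma extS_eq (s : ℕ × ℕ → ℂ) {i j : ℤ} (a l : ℕ) (hi : i = ((a + l : ℕ) : ℤ))
    (hj : j = (l : ℤ)) : extS s i j = s (a + l, l) := by
  unfold extS
  subst hi hj
  rw [if_pos (by omega), Int.toNat_natCast, Int.toNat_natCast]

lemma extS_zero (s : ℕ × ℕ → ℂ) {i j : ℤ} (h : i < j) : extS s i j = 0 := by
  unfold extS
  rw [if_neg (by omega)]

lemma ext_up (n : ℕ) (b : ℕ → ℕ → ℂ) {i j : ℤ} (a l : ℕ) (hi : i = ((a + l : ℕ) : ℤ))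
    (hj : j = (l : ℤ)) : extS (phi n b) i j = kap a * gj n l * b l a := by
  rw [extS_eq _ a l hi hj, phi_apply]

lemma ext_one (n : ℕ) (b : ℕ → ℕ → ℂ) {i j : ℤ} (a l : ℕ) (hi : i = (a : ℤ) + l - 1)
    (hj : j = (l : ℤ)) :
    extS (phi n b) i j = -Complex.I * a * kap a * gj n l * b l (a - 1) := by
  rcases a with _ | a
  · rw [extS_zero _ (by push_cast at hi; omega)]; simp
  · rw [ext_up n b a l (by push_cast at *; omega) hj]
    have h := kap_succ a
    have hI := Complex.I_mul_I
    simp only [Nat.add_sub_cancel]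
    push_cast
    linear_combination (Complex.I * gj n l * b l a) * h + (kap a * gj n l * b l a) * hI

lemma ext_two (n : ℕ) (b : ℕ → ℕ → ℂ) {i j : ℤ} (a l : ℕ) (hi : i = (a : ℤ) + l - 2)
    (hj : j = (l : ℤ)) :
    extS (phi n b) i j = -(a * ((a : ℂ) - 1)) * kap a * gj n l * b l (a - 2) := by
  rcases a with _ | _ | a
  · rw [extS_zero _ (by push_cast at hi; omega)]; simp
  · rw [extS_zero _ (by push_cast at hi; omega)]; simp
  · rw [ext_up n b a l (by push_cast at *; omega) hj]
    have h := kap_succ a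
    have h' := kap_succ (a + 1)
    have hI := Complex.I_mul_I
    simp only [show a + 1 + 1 - 2 = a by omega]
    push_cast at *
    linear_combination (gj n l * b l a) * ((a + 1) * h' + Complex.I * h + kap a * hI)

lemma qd_rels {n : ℕ} (hne : Even n) (lam : ℂ) (i : ℕ) :
    ((n : ℂ) + 2 * i + 1) * (qd n lam (i + 1) + 1 / 2) = lam + (n : ℂ) / 2 + 1 / 2 + i ∧
    ((n : ℂ) + 2 * i - 1) * (qd n lam i - 1 / 2) = lam - (n : ℂ) / 2 + 1 / 2 - i ∧
    ((n : ℂ) + 2 * i - 1) * ((n : ℂ) + 2 * i + 1) * (qd n lam i - qd n lam (i + 1)) = 2 * lam ∧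
    ((n : ℂ) + 2 * i - 1) * ((n : ℂ) + 2 * i + 1) * (qd n lam (i + 1) + qd n lam i) / 2
      = lam * ((n : ℂ) + 2 * i) := by
  have h1 := qd_mul hne lam i
  have h2 := qd_mul hne lam (i + 1)
  push_cast at h2
  refine ⟨by linear_combination h2, by linear_combination h1, ?_, ?_⟩
  · linear_combination ((n : ℂ) + 2 * i + 1) * h1 - ((n : ℂ) + 2 * i - 1) * h2
  · linear_combination ((n : ℂ) + 2 * i + 1) / 2 * h1 + ((n : ℂ) + 2 * i - 1) / 2 * h2

lemma fac_ne {n : ℕ} (hne : Even n) (i a j : ℕ) :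
    ((n : ℂ) + 2 * i - 1) * ((n : ℂ) + 2 * i + 1) * kap a * gj n j ≠ 0 := by
  have h1 := den_ne hne i
  have h2 := den_ne hne (i + 1)
  have h3 : (n : ℂ) + 2 * i + 1 ≠ 0 := by
    push_cast at h2; intro h; apply h2; linear_combination h
  exact mul_ne_zero (mul_ne_zero (mul_ne_zero h1 h3) (kap_ne a)) (gj_ne hne j)

lemma phi_mem_iff {n : ℕ} (hne : Even n) (eps lam nu : ℂ) (b : ℕ → ℕ → ℂ) :
    phi n b ∈ Vsp n eps lam nu ↔ IsQ n eps lam nu b := by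
  have hI := Complex.I_mul_I
  have hzero : ∀ p : ℕ × ℕ, p.1 < p.2 → phi n b p = 0 := by
    intro p hp
    unfold phi
    rw [if_neg (by omega)]
  have e1 : ∀ a j : ℕ, (((n : ℂ) + 2 * ((a + j : ℕ) : ℂ) - 1)
            * ((n : ℂ) + 2 * ((a + j : ℕ) : ℂ) + 1)
            * (nu + ((n : ℂ) - 1) / 2 + 1 / 2 + j) * phi n b (a + j, j)
          = ((n : ℂ) + 2 * ((a + j : ℕ) : ℂ) - 1) * ((n : ℂ) + 2 * j - 1)
              * (lam + (n : ℂ) / 2 + 1 / 2 + ((a + j : ℕ) : ℂ))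
              * extS (phi n b) (((a + j : ℕ) : ℤ) + 1) ((j : ℤ) + 1)
            + eps * (-1 : ℂ) ^ (a + j - j + 1) * 2 * ((n : ℂ) + 2 * j - 1)
              * Complex.I * lam * extS (phi n b) ((a + j : ℕ) : ℤ) ((j : ℤ) + 1)
            - ((n : ℂ) + 2 * ((a + j : ℕ) : ℂ) + 1) * ((n : ℂ) + 2 * j - 1)
              * (lam - (n : ℂ) / 2 + 1 / 2 - ((a + j : ℕ) : ℂ))
              * extS (phi n b) (((a + j : ℕ) : ℤ) - 1) ((j : ℤ) + 1)) ↔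
      opA n eps lam j (b (j + 1)) a = (nu + mj n j) * b j a := by
    intro a j
    refine Iff.trans ?_ (mul_right_inj' (fac_ne hne (a + j) a j))
    obtain ⟨hL, hL', hD, -⟩ := qd_rels hne lam (a + j)
    have hg := gj_succ hne j
    rw [phi_apply, ext_up n b a (j + 1) (by push_cast; ring) (by push_cast; ring),
      ext_one n b a (j + 1) (by push_cast; ring) (by push_cast; ring),
      ext_two n b a (j + 1) (by push_cast; ring) (by push_cast; ring), Nat.add_sub_cancel,
      pow_succ, opA, mj, sg, hg]
    push_cast at *
    constructor
    · intro E
      linear_combination kap a * ((n : ℂ) + 2 * j - 1) * gj n (j + 1)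
          * (((n : ℂ) + 2 * (a + j) - 1) * b (j + 1) a * hL
            - eps * (-1) ^ a * a * b (j + 1) (a - 1) * hD
            + a * (a - 1) * ((n : ℂ) + 2 * (a + j) + 1) * b (j + 1) (a - 2) * hL')
        - E - eps * (-1) ^ a * 2 * ((n : ℂ) + 2 * j - 1) * lam * a * kap a * gj n (j + 1)
          * b (j + 1) (a - 1) * hI
    · intro E
      linear_combination kap a * ((n : ℂ) + 2 * j - 1) * gj n (j + 1)
          * (((n : ℂ) + 2 * (a + j) - 1) * b (j + 1) a * hL
            - eps * (-1) ^ a * a * b (j + 1) (a - 1) * hD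
            + a * (a - 1) * ((n : ℂ) + 2 * (a + j) + 1) * b (j + 1) (a - 2) * hL')
        - E - eps * (-1) ^ a * 2 * ((n : ℂ) + 2 * j - 1) * lam * a * kap a * gj n (j + 1)
          * b (j + 1) (a - 1) * hI
  have e2 : ∀ a j : ℕ, ((((n : ℂ) + 2 * ((a + j : ℕ) : ℂ) - 1)
            * ((n : ℂ) + 2 * ((a + j : ℕ) : ℂ) + 1) * nu
            - eps * (-1 : ℂ) ^ (a + j - j) * ((n : ℂ) + 2 * ((a + j : ℕ) : ℂ))
              * ((n : ℂ) + 2 * j - 1) * lam) * phi n b (a + j, j)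
          = -((((a + j : ℕ) : ℂ) - j + 1)) * ((n : ℂ) + 2 * ((a + j : ℕ) : ℂ) - 1) * Complex.I
              * (lam + (n : ℂ) / 2 + 1 / 2 + ((a + j : ℕ) : ℂ))
              * extS (phi n b) (((a + j : ℕ) : ℤ) + 1) (j : ℤ)
            + ((n : ℂ) + 2 * ((a + j : ℕ) : ℂ) + 1) * ((n : ℂ) + ((a + j : ℕ) : ℂ) + j - 1)
              * Complex.I * (lam - (n : ℂ) / 2 + 1 / 2 - ((a + j : ℕ) : ℂ))
              * extS (phi n b) (((a + j : ℕ) : ℤ) - 1) (j : ℤ)) ↔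
      opT n eps lam j (b j) a = nu * b j a := by
    intro a j
    refine Iff.trans ?_ (mul_right_inj' (fac_ne hne (a + j) a j))
    obtain ⟨hL, hL', -, hS⟩ := qd_rels hne lam (a + j)
    have hk := kap_succ a
    rw [phi_apply, ext_up n b (a + 1) j (by push_cast; ring) rfl,
      ext_one n b a j (by push_cast; ring) rfl, Nat.add_sub_cancel,
      opT, sg]
    push_cast at *
    constructor
    · intro E
      linear_combination kap a * gj n j
          * (eps * (-1) ^ a * ((n : ℂ) + 2 * j - 1) * b j a * hS
            + ((n : ℂ) + 2 * (a + j) - 1) * b j (a + 1) * hL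
            + a * ((n : ℂ) + a + 2 * j - 1) * ((n : ℂ) + 2 * (a + j) + 1) * b j (a - 1) * hL')
        - E + ((n : ℂ) + 2 * (a + j) - 1) * Complex.I * (lam + (n : ℂ) / 2 + 1 / 2 + (a + j))
            * gj n j * b j (a + 1) * hk
        + kap a * gj n j * (((n : ℂ) + 2 * (a + j) - 1) * (lam + (n : ℂ) / 2 + 1 / 2 + (a + j))
            * b j (a + 1)
          + ((n : ℂ) + 2 * (a + j) + 1) * ((n : ℂ) + a + 2 * j - 1)
            * (lam - (n : ℂ) / 2 + 1 / 2 - (a + j)) * a * b j (a - 1)) * hI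
    · intro E
      linear_combination kap a * gj n j
          * (eps * (-1) ^ a * ((n : ℂ) + 2 * j - 1) * b j a * hS
            + ((n : ℂ) + 2 * (a + j) - 1) * b j (a + 1) * hL
            + a * ((n : ℂ) + a + 2 * j - 1) * ((n : ℂ) + 2 * (a + j) + 1) * b j (a - 1) * hL')
        - E + ((n : ℂ) + 2 * (a + j) - 1) * Complex.I * (lam + (n : ℂ) / 2 + 1 / 2 + (a + j))
            * gj n j * b j (a + 1) * hk
        + kap a * gj n j * (((n : ℂ) + 2 * (a + j) - 1) * (lam + (n : ℂ) / 2 + 1 / 2 + (a + j))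
            * b j (a + 1)
          + ((n : ℂ) + 2 * (a + j) + 1) * ((n : ℂ) + a + 2 * j - 1)
            * (lam - (n : ℂ) / 2 + 1 / 2 - (a + j)) * a * b j (a - 1)) * hI
  have e3 : ∀ a j : ℕ, (((n : ℂ) + 2 * ((a + (j + 1) : ℕ) : ℂ) - 1)
            * ((n : ℂ) + 2 * ((a + (j + 1) : ℕ) : ℂ) + 1) * ((n : ℂ) + 2 * ((j + 1 : ℕ) : ℂ) - 3)
            * (nu - ((n : ℂ) - 1) / 2 + 1 / 2 - ((j + 1 : ℕ) : ℂ)) * phi n b (a + (j + 1), j + 1)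
          = -((((a + (j + 1) : ℕ) : ℂ) - ((j + 1 : ℕ) : ℂ) + 1))
              * ((((a + (j + 1) : ℕ) : ℂ) - ((j + 1 : ℕ) : ℂ) + 2))
              * ((n : ℂ) + 2 * ((a + (j + 1) : ℕ) : ℂ) - 1)
              * (lam + (n : ℂ) / 2 + 1 / 2 + ((a + (j + 1) : ℕ) : ℂ))
              * extS (phi n b) (((a + (j + 1) : ℕ) : ℤ) + 1) (((j + 1 : ℕ) : ℤ) - 1)
            + eps * (-1 : ℂ) ^ (a + (j + 1) - (j + 1) + 1) * 2
              * ((((a + (j + 1) : ℕ) : ℂ) - ((j + 1 : ℕ) : ℂ) + 1))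
              * ((n : ℂ) + ((a + (j + 1) : ℕ) : ℂ) + ((j + 1 : ℕ) : ℂ) - 1)
              * Complex.I * lam * extS (phi n b) ((a + (j + 1) : ℕ) : ℤ) (((j + 1 : ℕ) : ℤ) - 1)
            + ((n : ℂ) + 2 * ((a + (j + 1) : ℕ) : ℂ) + 1)
              * ((n : ℂ) + ((a + (j + 1) : ℕ) : ℂ) + ((j + 1 : ℕ) : ℂ) - 2)
              * ((n : ℂ) + ((a + (j + 1) : ℕ) : ℂ) + ((j + 1 : ℕ) : ℂ) - 1)
              * (lam - (n : ℂ) / 2 + 1 / 2 - ((a + (j + 1) : ℕ) : ℂ))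
              * extS (phi n b) (((a + (j + 1) : ℕ) : ℤ) - 1) (((j + 1 : ℕ) : ℤ) - 1)) ↔
      opB n eps lam j (b j) a = (nu - mj n j) * b (j + 1) a := by
    intro a j
    refine Iff.trans ?_ (mul_right_inj' (fac_ne hne (a + (j + 1)) a j))
    obtain ⟨hL, hL', hD, -⟩ := qd_rels hne lam (a + (j + 1))
    have hg := gj_succ hne j
    have hk := kap_succ a
    have hk2 : ((a : ℂ) + 1) * ((a : ℂ) + 2) * kap (a + 2) = - kap a := by
      have h := kap_succ (a + 1)
      push_cast at h
      linear_combination (a + 1) * h + Complex.I * hk + kap a * hI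
    rw [phi_apply, ext_up n b (a + 2) j (by push_cast; ring) (by push_cast; ring),
      ext_up n b (a + 1) j (by push_cast; ring) (by push_cast; ring),
      ext_up n b a j (by push_cast; ring) (by push_cast; ring), Nat.add_sub_cancel,
      pow_succ, opB, mj, sg,
      show a + j + 2 = a + (j + 1) + 1 by omega, show a + j + 1 = a + (j + 1) by omega]
    push_cast at *
    constructor
    · intro E
      linear_combination kap a * gj n j
          * (((n : ℂ) + 2 * (a + (j + 1)) - 1) * b j (a + 2) * hL
            + eps * (-1) ^ a * ((n : ℂ) + a + 2 * j + 1) * b j (a + 1) * hD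
            + ((n : ℂ) + a + 2 * j) * ((n : ℂ) + a + 2 * j + 1)
              * ((n : ℂ) + 2 * (a + (j + 1)) + 1) * b j a * hL')
        - E + ((n : ℂ) + 2 * (a + (j + 1)) - 1) * (lam + (n : ℂ) / 2 + 1 / 2 + (a + (j + 1)))
            * gj n j * b j (a + 2) * hk2
        + eps * (-1) ^ a * 2 * ((n : ℂ) + a + 2 * j + 1) * lam * gj n j * b j (a + 1)
          * (Complex.I * hk + kap a * hI)
        - ((n : ℂ) + 2 * (a + (j + 1)) - 1) * ((n : ℂ) + 2 * (a + (j + 1)) + 1) * kap a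
          * (nu - ((n : ℂ) / 2 + j)) * b (j + 1) a * hg
    · intro E
      linear_combination kap a * gj n j
          * (((n : ℂ) + 2 * (a + (j + 1)) - 1) * b j (a + 2) * hL
            + eps * (-1) ^ a * ((n : ℂ) + a + 2 * j + 1) * b j (a + 1) * hD
            + ((n : ℂ) + a + 2 * j) * ((n : ℂ) + a + 2 * j + 1)
              * ((n : ℂ) + 2 * (a + (j + 1)) + 1) * b j a * hL')
        - E + ((n : ℂ) + 2 * (a + (j + 1)) - 1) * (lam + (n : ℂ) / 2 + 1 / 2 + (a + (j + 1)))
            * gj n j * b j (a + 2) * hk2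
        + eps * (-1) ^ a * 2 * ((n : ℂ) + a + 2 * j + 1) * lam * gj n j * b j (a + 1)
          * (Complex.I * hk + kap a * hI)
        - ((n : ℂ) + 2 * (a + (j + 1)) - 1) * ((n : ℂ) + 2 * (a + (j + 1)) + 1) * kap a
          * (nu - ((n : ℂ) / 2 + j)) * b (j + 1) a * hg
  constructor
  · rintro ⟨-, h1, h2, h3⟩
    exact ⟨fun j a => (e2 a j).mp (h2 (a + j) j (by omega)),
      fun j a => (e1 a j).mp (h1 (a + j) j (by omega)),
      fun j a => (e3 a j).mp (h3 (a + (j + 1)) (j + 1) (by omega) (by omega))⟩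
  · rintro ⟨h1, h2, h3⟩
    refine ⟨hzero, fun i j hij => ?_, fun i j hij => ?_, fun i j hj hij => ?_⟩
    · obtain ⟨a, rfl⟩ : ∃ a, i = a + j := ⟨i - j, by omega⟩
      exact (e1 a j).mpr (h2 j a)
    · obtain ⟨a, rfl⟩ : ∃ a, i = a + j := ⟨i - j, by omega⟩
      exact (e2 a j).mpr (h1 j a)
    · obtain ⟨j, rfl⟩ : ∃ c, j = c + 1 := ⟨j - 1, by omega⟩
      obtain ⟨a, rfl⟩ : ∃ a, i = a + (j + 1) := ⟨i - (j + 1), by omega⟩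
      exact (e3 a j).mpr (h3 j a)

lemma exists_phi {n : ℕ} (hne : Even n) {eps lam nu : ℂ} {s : ℕ × ℕ → ℂ}
    (hs : s ∈ Vsp n eps lam nu) : ∃ b, IsQ n eps lam nu b ∧ s = phi n b := by
  have h : s = phi n (fun j a => (kap a * gj n j)⁻¹ * s (a + j, j)) := by
    funext ⟨i, j⟩
    by_cases hij : j ≤ i
    · obtain ⟨a, rfl⟩ : ∃ a, i = a + j := ⟨i - j, by omega⟩
      rw [phi_apply, mul_inv_cancel_left₀ (mul_ne_zero (kap_ne a) (gj_ne hne j))]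
    · rw [hs.1 (i, j) (by simpa using hij)]
      unfold phi
      rw [if_neg (by simpa using hij)]
  refine ⟨_, ?_, h⟩
  rw [← phi_mem_iff hne, ← h]
  exact hs

lemma phi_eq_zero {n : ℕ} (hne : Even n) {b : ℕ → ℕ → ℂ} (h : phi n b = 0) (j a : ℕ) :
    b j a = 0 := by
  have h1 := congrFun h (a + j, j)
  rw [phi_apply] at h1
  exact (mul_eq_zero.mp h1).resolve_left (mul_ne_zero (kap_ne a) (gj_ne hne j))

lemma phi_comb (n : ℕ) (u w : ℕ → ℕ → ℂ) (c d : ℂ) :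
    phi n (fun j a => c * u j a + d * w j a) = c • phi n u + d • phi n w := by
  funext p
  simp only [phi, Pi.add_apply, Pi.smul_apply, smul_eq_mul]
  split_ifs
  · ring
  · ring

lemma rank_dim1 {n : ℕ} (hne : Even n) {eps lam nu : ℂ} (h : Dim1 n eps lam nu) :
    Module.rank ℂ ↥(Vsp n eps lam nu) = 1 := by
  obtain ⟨u, hu, ⟨j, a, hja⟩, h1⟩ := h
  rw [rank_submodule_eq_one_iff]
  refine ⟨phi n u, (phi_mem_iff hne _ _ _ _).mpr hu, fun h0 => hja (phi_eq_zero hne h0 j a), ?_⟩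
  intro s hs
  obtain ⟨b, hb, rfl⟩ := exists_phi hne hs
  obtain ⟨c, hc⟩ := h1 b hb
  rw [Submodule.mem_span_singleton]
  refine ⟨c, ?_⟩
  have := phi_comb n u u c 0
  rw [zero_smul, add_zero] at this
  rw [← this]
  congr 1
  funext j a
  rw [hc j a]; ring

lemma rank_dim2 {n : ℕ} (hne : Even n) {eps lam nu : ℂ} (h : Dim2 n eps lam nu) :
    Module.rank ℂ ↥(Vsp n eps lam nu) = 2 := by
  obtain ⟨u, w, hu, hw, ⟨j, a, hja⟩, hu0, hw0, h1⟩ := h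
  have hind : LinearIndependent ℂ ![phi n u, phi n w] := by
    rw [LinearIndependent.pair_iff]
    intro c d hcd
    rw [← phi_comb] at hcd
    have hz := phi_eq_zero hne hcd
    have hd : d = 0 := by
      have := hz 0 0
      simp only [hu0, mul_zero, zero_add] at this
      exact (mul_eq_zero.mp this).resolve_right hw0
    have hc := hz j a
    simp only [hd, zero_mul, add_zero] at hc
    exact ⟨(mul_eq_zero.mp hc).resolve_right hja, hd⟩
  have hspan : Vsp n eps lam nu = Submodule.span ℂ (Set.range ![phi n u, phi n w]) := by
    apply le_antisymm
    · intro s hs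
      obtain ⟨b, hb, rfl⟩ := exists_phi hne hs
      obtain ⟨c, d, hcd⟩ := h1 b hb
      have hb' : b = fun j a => c * u j a + d * w j a := funext fun j => funext fun a => hcd j a
      rw [hb', phi_comb, Matrix.range_cons, Matrix.range_cons, Matrix.range_empty,
        Set.union_empty, Set.singleton_union, Submodule.mem_span_pair]
      exact ⟨c, d, rfl⟩
    · rw [Submodule.span_le]
      rintro _ ⟨i, rfl⟩
      fin_cases i
      · exact (phi_mem_iff hne _ _ _ _).mpr hu
      · exact (phi_mem_iff hne _ _ _ _).mpr hw
  rw [hspan, rank_span hind, Cardinal.mk_range_eq _ hind.injective]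
  simp

theorem statement14 (n : ℕ) (hn : 0 < n) (hne : Even n) (lam nu : ℂ) :
    ((lam, nu) ∈ Lhat n →
      Module.rank ℂ ↥(Vsp n 1 lam nu) + Module.rank ℂ ↥(Vsp n (-1) lam nu) = 3)
    ∧ ((lam, nu) ∉ Lhat n →
      Module.rank ℂ ↥(Vsp n 1 lam nu) + Module.rank ℂ ↥(Vsp n (-1) lam nu) = 2) := by
  have p1 : (1 : ℂ) = 1 ∨ (1 : ℂ) = -1 := Or.inl rfl
  have p2 : (-1 : ℂ) = 1 ∨ (-1 : ℂ) = -1 := Or.inr rfl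
  constructor
  · rintro ⟨k, l, hlk, hk, hl⟩
    have hk' : lam = -((n : ℂ) / 2) - 1 / 2 - k := hk
    have hl' : nu = -mj n l := by
      have hl2 : nu = -(((n : ℂ) - 1) / 2) - 1 / 2 - l := hl
      rw [hl2, mj]; ring
    have hneg : sg (-1) (k - l) = - sg 1 (k - l) := by unfold sg; ring
    rcases sg_cases p1 (k - l) with hs | hs
    · rw [rank_dim2 hne (dim2_right hn hne p1 hlk hk' hl' hs),
        rank_dim1 hne (dim1_wrong hn hne p2 hlk hk' hl' (by rw [hneg, hs]))]
      norm_num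
    · rw [rank_dim1 hne (dim1_wrong hn hne p1 hlk hk' hl' hs),
        rank_dim2 hne (dim2_right hn hne p2 hlk hk' hl' (by rw [hneg, hs, neg_neg]))]
      norm_num
  · intro hnot
    have hd : ∀ eps : ℂ, (eps = 1 ∨ eps = -1) → Dim1 n eps lam nu := by
      intro eps he
      by_cases hlam : ∃ k : ℕ, lam = -((n : ℂ) / 2) - 1 / 2 - k
      · obtain ⟨k, hk⟩ := hlam
        refine dim1_nu hn hne he hk fun l hl hnu => hnot ⟨k, l, hl, hk, ?_⟩
        simp only [hnu, mj]; ring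
      · push Not at hlam
        exact dim1_generic hn hne he nu hlam
    rw [rank_dim1 hne (hd 1 p1), rank_dim1 hne (hd (-1) p2)]
    norm_num
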